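/- arXiv:1605.02891 — 4 statements merged into one kernel-verified Lean document; each statement's English description precedes it below -/
import Mathlib

section
/- If 𝒢 is an isomorphism-closed class of finite simple graphs each of which is planar, and 𝒢 contains a graph with at least two vertices, then 𝒢 is not closed under path-addition: there exist G ∈ 𝒢, distinct vertices u, v of G, and a path P of length at least |V(G)|−1 from u to v with new internal vertices such that for every supplementary edge set F the graph G ⊕ P ⊕ F is not in 𝒢, or some finite sequence of path-additions starting from a member of 𝒢 leaves 𝒢. In particular the class of all planar graphs is not closed under path-addition. -/
/-- Points of the plane `ℝ²`. -/
abbrev Plane : Type := ℝ × ℝ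

/-- The `i`-th vertex of a path from `a` to `b` whose internal vertices are
`w 0, …, w (t-1)` (so the path has length `t + 1`). -/
def chainVertex {α : Type*} (a b : α) {t : ℕ} (w : Fin t → α) (i : Fin (t + 2)) : α :=
  if _h0 : (i : ℕ) = 0 then a
  else if _h1 : (i : ℕ) = t + 1 then b
  else w ⟨(i : ℕ) - 1, by have := i.isLt; omega⟩

/-- The edge set of a path from `a` to `b` through the internal vertices
`w 0, …, w (t-1)`. -/
def chainEdges {α : Type*} (a b : α) {t : ℕ} (w : Fin t → α) : Set (Sym2 α) :=
  {e | ∃ i : Fin (t + 1),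
    e = s(chainVertex a b w (Fin.castSucc i), chainVertex a b w (Fin.succ i))}

/-- Path-addition `G ⊕ P ⊕ F`: the graph on `V ⊕ Fin t` obtained from `G` by adding an
internally vertex-disjoint path `P = (u, w₁, …, w_t, v)` with `t` new internal vertices
together with a set `F` of supplementary edges. -/
def pathAdd {V : Type*} (G : SimpleGraph V) (u v : V) (t : ℕ)
    (F : Set (Sym2 (V ⊕ Fin t))) : SimpleGraph (V ⊕ Fin t) :=
  SimpleGraph.fromEdgeSet
    ((Sym2.map Sum.inl '' G.edgeSet)
      ∪ chainEdges (Sum.inl u) (Sum.inl v) (fun i => Sum.inr i)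
      ∪ F)

/-- A valid supplementary edge set: every supplementary edge is a non-loop with at least
one endpoint among the internal vertices `w₁, …, w_t` of the added path. -/
def ValidSupp {V : Type*} {t : ℕ} (F : Set (Sym2 (V ⊕ Fin t))) : Prop :=
  ∀ e ∈ F, ¬ e.IsDiag ∧ ∃ i : Fin t, Sum.inr i ∈ e

/-- A drawing of a finite simple graph `G` in the plane: vertices are mapped to distinct
points, each edge to a continuous injective curve (parametrized over `[0,1]`) joining the
points of its endpoints, whose interior contains no vertex point; curves of two distinct
edges meet in finitely many points, and curves of edges sharing an endpoint meet only at
(the point of) that endpoint. -/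
structure Drawing {V : Type*} (G : SimpleGraph V) where
  pos : V → Plane
  curve : Sym2 V → ℝ → Plane
  pos_inj : Function.Injective pos
  curve_cont : ∀ e ∈ G.edgeSet, ContinuousOn (curve e) (Set.Icc 0 1)
  curve_inj : ∀ e ∈ G.edgeSet, Set.InjOn (curve e) (Set.Icc 0 1)
  curve_ends : ∀ x y : V, G.Adj x y →
    ({curve s(x, y) 0, curve s(x, y) 1} : Set Plane) = {pos x, pos y}
  no_vertex_interior : ∀ e ∈ G.edgeSet, ∀ s ∈ Set.Ioo (0 : ℝ) 1, ∀ x : V, curve e s ≠ pos x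
  finite_meets : ∀ e ∈ G.edgeSet, ∀ f ∈ G.edgeSet, e ≠ f →
    (curve e '' Set.Icc 0 1 ∩ curve f '' Set.Icc 0 1).Finite
  shared_endpoint : ∀ e ∈ G.edgeSet, ∀ f ∈ G.edgeSet, e ≠ f → ∀ x : V, x ∈ e → x ∈ f →
    curve e '' Set.Icc 0 1 ∩ curve f '' Set.Icc 0 1 ⊆ {pos x}

/-- `p` is a crossing point of the edges `e` and `f`: a point interior to both curves. -/
def Drawing.IsCrossingPt {V : Type*} {G : SimpleGraph V} (D : Drawing G)
    (e f : Sym2 V) (p : Plane) : Prop :=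
  e ∈ G.edgeSet ∧ f ∈ G.edgeSet ∧ e ≠ f ∧
    (∃ s ∈ Set.Ioo (0 : ℝ) 1, D.curve e s = p) ∧
    (∃ s ∈ Set.Ioo (0 : ℝ) 1, D.curve f s = p)

/-- Two edges cross in the drawing `D`. -/
def Drawing.Crosses {V : Type*} {G : SimpleGraph V} (D : Drawing G) (e f : Sym2 V) : Prop :=
  ∃ p : Plane, D.IsCrossingPt e f p

/-- The drawing `D` is crossing-free. -/
def Drawing.CrossingFree {V : Type*} {G : SimpleGraph V} (D : Drawing G) : Prop :=
  ∀ e f : Sym2 V, ¬ D.Crosses e f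

/-- A graph is planar if it admits a crossing-free drawing in the plane. -/
def IsPlanarGraph {V : Type*} (G : SimpleGraph V) : Prop :=
  ∃ D : Drawing G, D.CrossingFree

/-- An isomorphism-closed class of finite simple graphs. -/
def IsoClosed (𝒢 : ∀ V : Type, Fintype V → SimpleGraph V → Prop) : Prop :=
  ∀ (V W : Type) [iV : Fintype V] [iW : Fintype W]
    (G : SimpleGraph V) (H : SimpleGraph W),
    Nonempty (G ≃g H) → 𝒢 V iV G → 𝒢 W iW H

/-- A class of finite simple graphs is closed under path-addition if for every member
`G`, all distinct vertices `u, v` of `G`, and every internally vertex-disjoint path with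
new internal vertices of length at least `|V(G)| - 1`, there is a supplementary edge set
`F` such that `G ⊕ P ⊕ F` belongs to the class. -/
def ClosedUnderPathAddition (𝒢 : ∀ V : Type, Fintype V → SimpleGraph V → Prop) : Prop :=
  ∀ (V : Type) [iV : Fintype V] (G : SimpleGraph V), 𝒢 V iV G →
    ∀ u v : V, u ≠ v → ∀ t : ℕ, Fintype.card V - 1 ≤ t + 1 →
      ∃ F : Set (Sym2 (V ⊕ Fin t)), ValidSupp F ∧
        𝒢 (V ⊕ Fin t) inferInstance (pathAdd G u v t F)


namespace PathAddPlanar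

/-- Continuous logarithms exist on simply connected spaces. -/
lemma exists_log {A : Type*} [TopologicalSpace A] [SimplyConnectedSpace A]
    [LocallyPathConnectedSpace A] (a₀ : A) (f : A → ℂ) (hf : Continuous f) (h0 : ∀ a, f a ≠ 0) :
    ∃ g : A → ℂ, Continuous g ∧ ∀ a, Complex.exp (g a) = f a := by
  obtain ⟨F, ⟨-, hF⟩, -⟩ := Complex.isCoveringMapOn_exp.existsUnique_continuousMap_lifts
    (⟨f, hf⟩ : C(A, ℂ)) (a₀ := a₀) (e₀ := Complex.log (f a₀)) (Complex.exp_log (h0 a₀))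
    (fun a => by simpa using h0 a)
  exact ⟨F, F.continuous, fun a => congrFun hF a⟩

/-- Increments of continuous logarithms are well defined. -/
lemma log_incr_unique {f g h : ℝ → ℂ} (hg : Continuous g) (hh : Continuous h)
    (eg : ∀ s, Complex.exp (g s) = f s) (eh : ∀ s, Complex.exp (h s) = f s) :
    g 1 - g 0 = h 1 - h 0 := by
  have hfc : Continuous f := by
    have : f = fun s => Complex.exp (g s) := funext fun s => (eg s).symm
    rw [this]; fun_prop
  have hex := Complex.isCoveringMapOn_exp.existsUnique_continuousMap_lifts
    (⟨f, hfc⟩ : C(ℝ, ℂ)) (a₀ := 0) (e₀ := g 0) (eg 0)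
    (fun a => by have := Complex.exp_ne_zero (g a); rw [eg] at this; simpa using this)
  have e0 : Complex.exp (g 0 - h 0) = 1 := by
    rw [Complex.exp_sub, eg, eh, div_self]
    rw [← eg]; exact Complex.exp_ne_zero _
  have := hex.unique (y₁ := ⟨g, hg⟩) (y₂ := ⟨fun s => h s + (g 0 - h 0), by fun_prop⟩)
    ⟨rfl, funext eg⟩ ⟨by simp, funext fun s => by simp [Complex.exp_add, e0, eh]⟩
  have h1 := congrArg (fun F : C(ℝ, ℂ) => F 1) this
  simp at h1
  rw [h1]; ring

open Classical in
/-- Increment of `log (γ - v)` along the curve `γ`. -/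
noncomputable def dl (γ : ℝ → ℂ) (v : ℂ) : ℂ :=
  if h : ∃ g : ℝ → ℂ, Continuous g ∧ ∀ s, Complex.exp (g s) = γ s - v then
    h.choose 1 - h.choose 0 else 0

lemma dl_eq {γ g : ℝ → ℂ} {v : ℂ} (hg : Continuous g)
    (eg : ∀ s, Complex.exp (g s) = γ s - v) : dl γ v = g 1 - g 0 := by
  have h : ∃ g : ℝ → ℂ, Continuous g ∧ ∀ s, Complex.exp (g s) = γ s - v := ⟨g, hg, eg⟩
  rw [dl, dif_pos h]
  exact log_incr_unique h.choose_spec.1 hg h.choose_spec.2 eg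

/-- The value of `dl` modulo `2πi`. -/
lemma dl_mod {γ : ℝ → ℂ} (hγ : Continuous γ) {v A B : ℂ} (hv : ∀ s, γ s ≠ v)
    (hA : Complex.exp A = γ 0 - v) (hB : Complex.exp B = γ 1 - v) :
    ∃ n : ℤ, dl γ v = B - A + n * (2 * Real.pi * Complex.I) := by
  obtain ⟨g, hg, eg⟩ := exists_log (0 : ℝ) (fun s => γ s - v) (by fun_prop)
    (fun s => sub_ne_zero.2 (hv s))
  rw [dl_eq hg eg]
  obtain ⟨m, hm⟩ := Complex.exp_eq_exp_iff_exists_int.1 ((eg 0).trans hA.symm)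
  obtain ⟨n, hn⟩ := Complex.exp_eq_exp_iff_exists_int.1 ((eg 1).trans hB.symm)
  refine ⟨n - m, ?_⟩
  rw [hm, hn]; push_cast; ring

/-- The square relation for two disjoint curves. -/
lemma dl_square {γ δ : ℝ → ℂ} (hγ : Continuous γ) (hδ : Continuous δ)
    (hd : ∀ s t, γ s ≠ δ t) :
    dl γ (δ 0) - dl γ (δ 1) + dl δ (γ 1) - dl δ (γ 0) = 0 := by
  obtain ⟨g, hg, eg⟩ := exists_log ((0, 0) : ℝ × ℝ) (fun p => γ p.1 - δ p.2) (by fun_prop)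
    (fun p => sub_ne_zero.2 (hd _ _))
  have h1 : ∀ t, dl γ (δ t) = g (1, t) - g (0, t) := fun t =>
    dl_eq (g := fun s => g (s, t)) (by fun_prop) (fun s => eg (s, t))
  have h2 : ∀ s, dl δ (γ s) = (g (s, 1) + Real.pi * Complex.I) - (g (s, 0) + Real.pi * Complex.I) :=
    fun s => dl_eq (g := fun t => g (s, t) + Real.pi * Complex.I) (by fun_prop)
      (fun t => by rw [Complex.exp_add, eg, Complex.exp_pi_mul_I]; ring)
  rw [h1, h1, h2, h2]; ring

/-- A logarithm of `y j - y i`, with a `πi` shift for one of the two orders. -/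
noncomputable def lg (y : Fin 3 → ℂ) (i j : Fin 3) : ℂ :=
  if i < j then Complex.log (y j - y i) else Complex.log (y i - y j) + Real.pi * Complex.I

lemma exp_lg {y : Fin 3 → ℂ} (i j : Fin 3) (h : y i ≠ y j) :
    Complex.exp (lg y i j) = y j - y i := by
  unfold lg
  split_ifs
  · exact Complex.exp_log (sub_ne_zero.2 h.symm)
  · rw [Complex.exp_add, Complex.exp_log (sub_ne_zero.2 h), Complex.exp_pi_mul_I]; ring

/-- `K_{3,3}` has no drawing in which independent edges are disjoint. -/
theorem no_K33 (p q : Fin 3 → ℂ) (γ : Fin 3 → Fin 3 → ℝ → ℂ)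
    (hc : ∀ i j, Continuous (γ i j)) (h0 : ∀ i j, γ i j 0 = p i) (h1 : ∀ i j, γ i j 1 = q j)
    (hd : ∀ i j k l, i ≠ k → j ≠ l → ∀ s t, γ i j s ≠ γ k l t) : False := by
  have other : ∀ a : Fin 3, ∃ b, a ≠ b := by decide
  have hpγ : ∀ i j k, k ≠ i → ∀ s, γ i j s ≠ p k := fun i j k hk s => by
    obtain ⟨l, hl⟩ := other j
    rw [← h0 k l]; exact hd _ _ _ _ hk.symm hl _ _
  have hqγ : ∀ i j l, l ≠ j → ∀ s, γ i j s ≠ q l := fun i j l hl s => by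
    obtain ⟨k, hk⟩ := other i
    rw [← h1 k l]; exact hd _ _ _ _ hk hl.symm _ _
  have hpp : ∀ i k, i ≠ k → p i ≠ p k := fun i k h => by
    rw [← h0 i 0]; exact hpγ _ _ _ h.symm _
  have hqq : ∀ j l, j ≠ l → q j ≠ q l := fun j l h => by
    rw [← h1 0 j]; exact hqγ _ _ _ h.symm _
  have hqp : ∀ k j, q j ≠ p k := fun k j => by
    obtain ⟨i, hi⟩ := other k
    rw [← h1 i j]; exact hpγ _ _ _ hi _
  set PQ : Fin 3 → Fin 3 → ℂ := fun k j => Complex.log (q j - p k) with hPQ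
  have ePQ : ∀ k j, Complex.exp (PQ k j) = q j - p k := fun k j =>
    Complex.exp_log (sub_ne_zero.2 (hqp k j))
  have hn : ∀ k i j, ∃ n : ℤ, k ≠ i → dl (γ i j) (p k) =
      PQ k j - lg p k i + n * (2 * Real.pi * Complex.I) := fun k i j => by
    by_cases h : k = i
    · exact ⟨0, fun h' => absurd h h'⟩
    · obtain ⟨n, hn⟩ := dl_mod (hc i j) (hpγ i j k h) (A := lg p k i) (B := PQ k j)
        (by rw [exp_lg _ _ (hpp _ _ h), h0]) (by rw [ePQ, h1])
      exact ⟨n, fun _ => hn⟩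
  have hm : ∀ l i j, ∃ n : ℤ, l ≠ j → dl (γ i j) (q l) =
      lg q l j - (PQ i l + Real.pi * Complex.I) + n * (2 * Real.pi * Complex.I) := fun l i j => by
    by_cases h : l = j
    · exact ⟨0, fun h' => absurd h h'⟩
    · obtain ⟨n, hn⟩ := dl_mod (hc i j) (hqγ i j l h) (A := PQ i l + Real.pi * Complex.I)
        (B := lg q l j)
        (by rw [Complex.exp_add, ePQ, Complex.exp_pi_mul_I, h0]; ring)
        (by rw [exp_lg _ _ (hqq _ _ h), h1])
      exact ⟨n, fun _ => hn⟩
  choose n hn using hn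
  choose m hm using hm
  have hpi : (2 * Real.pi * Complex.I : ℂ) ≠ 0 := Complex.two_pi_I_ne_zero
  have key : ∀ i j k l, i < k → j ≠ l →
      n k i j - m l i j + m j k l - n i k l = if j < l then 1 else 0 := by
    intro i j k l hik hjl
    have h := dl_square (hc i j) (hc k l) (hd i j k l hik.ne hjl)
    rw [h0, h0, h1, h1, hn k i j hik.ne', hm l i j hjl.symm, hm j k l hjl, hn i k l hik.ne] at h
    have e1 : lg p k i = lg p i k + Real.pi * Complex.I := by
      simp [lg, hik, hik.not_gt]
    have key' : ((n k i j - m l i j + m j k l - n i k l : ℤ) : ℂ) * (2 * Real.pi * Complex.I)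
        = ((if j < l then 1 else 0 : ℤ) : ℂ) * (2 * Real.pi * Complex.I) := by
      rcases lt_or_gt_of_ne hjl with hlt | hlt
      · have e2 : lg q l j = lg q j l + Real.pi * Complex.I := by
          simp [lg, hlt, hlt.not_gt]
        rw [e1, e2] at h
        simp only [hlt, if_true]
        push_cast
        linear_combination h
      · have e2 : lg q j l = lg q l j + Real.pi * Complex.I := by
          simp [lg, hlt, hlt.not_gt]
        rw [e1, e2] at h
        simp only [hlt.not_gt, if_false]
        push_cast
        linear_combination h
    exact_mod_cast mul_right_cancel₀ hpi key'
  have k1 := fun j l h => key 0 j 1 l (by decide) h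
  have k2 := fun j l h => key 0 j 2 l (by decide) h
  have k3 := fun j l h => key 1 j 2 l (by decide) h
  have a1 := k1 0 1 (by decide)
  have a2 := k1 0 2 (by decide)
  have a3 := k1 1 2 (by decide)
  have a4 := k1 1 0 (by decide)
  have a5 := k1 2 0 (by decide)
  have a6 := k1 2 1 (by decide)
  have b1 := k2 0 1 (by decide)
  have b2 := k2 0 2 (by decide)
  have b3 := k2 1 2 (by decide)
  have b4 := k2 1 0 (by decide)
  have b5 := k2 2 0 (by decide)
  have b6 := k2 2 1 (by decide)
  have c1 := k3 0 1 (by decide)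
  have c2 := k3 0 2 (by decide)
  have c3 := k3 1 2 (by decide)
  have c4 := k3 1 0 (by decide)
  have c5 := k3 2 0 (by decide)
  have c6 := k3 2 1 (by decide)
  simp at a1 a2 a3 a4 a5 a6 b1 b2 b3 b4 b5 b6 c1 c2 c3 c4 c5 c6
  omega

/-- The part of a drawing spanned by a vertex set `S`. -/
def img {V : Type*} {G : SimpleGraph V} (D : Drawing G) (S : Set V) : Set Plane :=
  D.pos '' S ∪ {z | ∃ x ∈ S, ∃ y ∈ S, G.Adj x y ∧ z ∈ D.curve s(x, y) '' Set.Icc 0 1}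

/-- Adjacency inside a vertex set. -/
def AdjIn {V : Type*} (G : SimpleGraph V) (S : Set V) (x y : V) : Prop :=
  G.Adj x y ∧ x ∈ S ∧ y ∈ S

lemma joined_edge {V : Type*} {G : SimpleGraph V} (D : Drawing G) {S : Set V} {x y : V}
    (h : AdjIn G S x y) : JoinedIn (img D S) (D.pos x) (D.pos y) := by
  obtain ⟨hxy, hx, hy⟩ := h
  have hc := D.curve_cont s(x, y) hxy
  have hpc : IsPathConnected (D.curve s(x, y) '' Set.Icc 0 1) :=
    ((convex_Icc (0 : ℝ) 1).isPathConnected ⟨0, by simp⟩).image' hc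
  have he := D.curve_ends x y hxy
  have hmem : ∀ z ∈ ({D.pos x, D.pos y} : Set Plane), z ∈ D.curve s(x, y) '' Set.Icc 0 1 := by
    rw [← he]
    rintro z (rfl | rfl)
    · exact ⟨0, by simp, rfl⟩
    · exact ⟨1, by simp, rfl⟩
  refine (hpc.joinedIn _ (hmem _ (by simp)) _ (hmem _ (by simp))).mono ?_
  intro z hz
  exact Or.inr ⟨x, hx, y, hy, hxy, hz⟩

lemma joined_chain {V : Type*} {G : SimpleGraph V} (D : Drawing G) {S : Set V} {x y : V}
    (hx : x ∈ S) (h : Relation.ReflTransGen (AdjIn G S) x y) :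
    JoinedIn (img D S) (D.pos x) (D.pos y) := by
  induction h with
  | refl => exact JoinedIn.refl (Or.inl ⟨x, hx, rfl⟩)
  | tail _ h ih => exact ih.trans (joined_edge D h)

lemma mem_img {V : Type*} {G : SimpleGraph V} (D : Drawing G) {S : Set V} {z : Plane}
    (hz : z ∈ img D S) : (∃ x ∈ S, z = D.pos x) ∨
      ∃ x ∈ S, ∃ y ∈ S, G.Adj x y ∧ ∃ s ∈ Set.Ioo (0 : ℝ) 1, D.curve s(x, y) s = z := by
  rcases hz with ⟨x, hx, rfl⟩ | ⟨x, hx, y, hy, hxy, s, hs, rfl⟩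
  · exact Or.inl ⟨x, hx, rfl⟩
  · have he := D.curve_ends x y hxy
    have hmem : ∀ z ∈ ({D.curve s(x, y) 0, D.curve s(x, y) 1} : Set Plane),
        ∃ x ∈ S, z = D.pos x := by
      rw [he]
      rintro z (rfl | rfl)
      · exact ⟨x, hx, rfl⟩
      · exact ⟨y, hy, rfl⟩
    rcases hs.1.eq_or_lt with h | h
    · exact Or.inl (hmem _ (by simp [← h]))
    rcases hs.2.eq_or_lt with h' | h'
    · exact Or.inl (hmem _ (by simp [h']))
    exact Or.inr ⟨x, hx, y, hy, hxy, s, ⟨h, h'⟩, rfl⟩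

lemma img_disjoint {V : Type*} {G : SimpleGraph V} (D : Drawing G) (hD : D.CrossingFree)
    {S T : Set V} (h : Disjoint S T) : Disjoint (img D S) (img D T) := by
  rw [Set.disjoint_left] at h ⊢
  intro z hz hz'
  rcases mem_img D hz with ⟨x, hx, rfl⟩ | ⟨x, hx, y, hy, hxy, s, hs, hsz⟩ <;>
  rcases mem_img D hz' with ⟨x', hx', e⟩ | ⟨x', hx', y', hy', hxy', s', hs', hsz'⟩
  · exact h hx (D.pos_inj e ▸ hx')
  · exact D.no_vertex_interior _ hxy' s' hs' x hsz'
  · exact D.no_vertex_interior _ hxy s hs x' (hsz.trans e)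
  · refine hD s(x, y) s(x', y') ⟨z, hxy, hxy', ?_, ⟨s, hs, hsz⟩, ⟨s', hs', hsz'⟩⟩
    intro e
    have : x ∈ s(x', y') := e ▸ Sym2.mem_mk_left x y
    rcases Sym2.mem_iff.1 this with rfl | rfl
    · exact h hx hx'
    · exact h hx hy'

/-- A (partial) `K_{3,3}`-subdivision in `G`: branch vertices `p i`, `q j`, and for the pairs in
the list `T` connections inside vertex sets `S i j`, disjoint for independent pairs. -/
structure Model {V : Type*} (G : SimpleGraph V) (T : List (Fin 3 × Fin 3)) where
  p : Fin 3 → V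
  q : Fin 3 → V
  S : Fin 3 → Fin 3 → Set V
  p_inj : Function.Injective p
  q_inj : Function.Injective q
  p_ne_q : ∀ i j, p i ≠ q j
  mem : ∀ i j, (i, j) ∈ T → p i ∈ S i j
  chain : ∀ i j, (i, j) ∈ T → Relation.ReflTransGen (AdjIn G (S i j)) (p i) (q j)
  p_mem : ∀ i j, (i, j) ∈ T → ∀ k, p k ∈ S i j → k = i
  q_mem : ∀ i j, (i, j) ∈ T → ∀ l, q l ∈ S i j → l = j
  disj : ∀ i j k l, (i, j) ∈ T → (k, l) ∈ T → i ≠ k → j ≠ l → Disjoint (S i j) (S k l)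

lemma not_planar_of_model {V : Type*} {G : SimpleGraph V} {T : List (Fin 3 × Fin 3)}
    (M : Model G T) (hT : ∀ e, e ∈ T) : ¬ IsPlanarGraph G := by
  rintro ⟨D, hD⟩
  have hJ : ∀ i j, JoinedIn (img D (M.S i j)) (D.pos (M.p i)) (D.pos (M.q j)) := fun i j =>
    joined_chain D (M.mem i j (hT _)) (M.chain i j (hT _))
  choose P hP using hJ
  let φ : Plane → ℂ := fun z => Complex.equivRealProdCLM.symm z
  have hφ : Continuous φ := Complex.equivRealProdCLM.symm.continuous
  have hφi : Function.Injective φ := Complex.equivRealProdCLM.symm.injective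
  have hmem : ∀ i j s, (P i j).extend s ∈ img D (M.S i j) := fun i j s => by
    have : (P i j).extend s ∈ Set.range (P i j) := by
      rw [← (P i j).extend_range]; exact ⟨s, rfl⟩
    obtain ⟨t, ht⟩ := this
    rw [← ht]; exact hP i j t
  refine no_K33 (fun i => φ (D.pos (M.p i))) (fun j => φ (D.pos (M.q j)))
    (fun i j s => φ ((P i j).extend s)) (fun i j => hφ.comp (P i j).continuous_extend)
    (fun i j => by simp) (fun i j => by simp) ?_
  intro i j k l hik hjl s t e
  exact Set.disjoint_left.1 (img_disjoint D hD (M.disj i j k l (hT _) (hT _) hik hjl))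
    (hmem i j s) (hφi e ▸ hmem k l t)

lemma pathAdd_adj_inl {V : Type*} {G : SimpleGraph V} {u v : V} {t : ℕ}
    {F : Set (Sym2 (V ⊕ Fin t))} {x y : V} (h : G.Adj x y) :
    (pathAdd G u v t F).Adj (Sum.inl x) (Sum.inl y) := by
  rw [pathAdd, SimpleGraph.fromEdgeSet_adj]
  refine ⟨Or.inl (Or.inl ⟨s(x, y), h, by simp⟩), ?_⟩
  simpa using h.ne

/-- The vertex set of the added path. -/
def newSet {V : Type*} (u v : V) (t : ℕ) : Set (V ⊕ Fin t) :=
  {Sum.inl u, Sum.inl v} ∪ Set.range Sum.inr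

lemma chainVertex_mem {V : Type*} (u v : V) (t : ℕ) (i : Fin (t + 2)) :
    chainVertex (Sum.inl u : V ⊕ Fin t) (Sum.inl v) (fun i => Sum.inr i) i ∈ newSet u v t := by
  unfold chainVertex newSet
  split_ifs <;> simp

lemma chainVertex_ne {V : Type*} {u v : V} (huv : u ≠ v) (t : ℕ) (i : Fin (t + 1)) :
    chainVertex (Sum.inl u : V ⊕ Fin t) (Sum.inl v) (fun i => Sum.inr i) i.castSucc ≠
    chainVertex (Sum.inl u : V ⊕ Fin t) (Sum.inl v) (fun i => Sum.inr i) i.succ := by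
  have := i.isLt
  have e1 : (i.castSucc : ℕ) = i := rfl
  have e2 : (i.succ : ℕ) = i + 1 := Fin.val_succ i
  simp only [chainVertex, e1, e2]
  split_ifs <;> simp_all <;> omega

lemma new_chain {V : Type*} (G : SimpleGraph V) {u v : V} (huv : u ≠ v) (t : ℕ)
    (F : Set (Sym2 (V ⊕ Fin t))) :
    Relation.ReflTransGen (AdjIn (pathAdd G u v t F) (newSet u v t))
      (Sum.inl u) (Sum.inl v) := by
  have H : ∀ i : Fin (t + 2), Relation.ReflTransGen
      (AdjIn (pathAdd G u v t F) (newSet u v t)) (Sum.inl u)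
      (chainVertex (Sum.inl u : V ⊕ Fin t) (Sum.inl v) (fun i => Sum.inr i) i) := by
    intro i
    induction i using Fin.induction with
    | zero => simp [chainVertex]; exact Relation.ReflTransGen.refl
    | succ i ih =>
      refine ih.tail ⟨?_, chainVertex_mem _ _ _ _, chainVertex_mem _ _ _ _⟩
      rw [pathAdd, SimpleGraph.fromEdgeSet_adj]
      exact ⟨Or.inl (Or.inr ⟨i, rfl⟩), chainVertex_ne huv t i⟩
  have := H (Fin.last _)
  simpa [chainVertex] using this

open Classical in
/-- Extending a model by one path-addition. -/
noncomputable def Model.extend {V : Type*} {G : SimpleGraph V} {T : List (Fin 3 × Fin 3)}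
    (M : Model G T) (a b : Fin 3) (t : ℕ) (F : Set (Sym2 (V ⊕ Fin t))) :
    Model (pathAdd G (M.p a) (M.q b) t F) ((a, b) :: T) where
  p i := Sum.inl (M.p i)
  q j := Sum.inl (M.q j)
  S i j := if (i, j) = (a, b) then newSet (M.p a) (M.q b) t else Sum.inl '' M.S i j
  p_inj := Sum.inl_injective.comp M.p_inj
  q_inj := Sum.inl_injective.comp M.q_inj
  p_ne_q i j h := M.p_ne_q i j (Sum.inl_injective h)
  mem i j h := by
    by_cases e : (i, j) = (a, b)
    · rw [if_pos e]; cases e; simp [newSet]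
    · rw [if_neg e]
      exact ⟨_, M.mem i j ((List.mem_cons.1 h).resolve_left e), rfl⟩
  chain i j h := by
    by_cases e : (i, j) = (a, b)
    · rw [if_pos e]; cases e; exact new_chain G (M.p_ne_q _ _) t F
    · rw [if_neg e]
      refine (M.chain i j ((List.mem_cons.1 h).resolve_left e)).lift Sum.inl ?_
      rintro x y ⟨h1, h2, h3⟩
      exact ⟨pathAdd_adj_inl h1, ⟨x, h2, rfl⟩, ⟨y, h3, rfl⟩⟩
  p_mem i j h k hk := by
    by_cases e : (i, j) = (a, b)
    · rw [if_pos e] at hk; cases e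
      simp only [newSet, Set.mem_union, Set.mem_insert_iff, Set.mem_singleton_iff, Set.mem_range,
        Sum.inl.injEq, M.p_inj.eq_iff, M.p_ne_q] at hk
      simpa using hk
    · rw [if_neg e] at hk
      obtain ⟨x, hx, hxe⟩ := hk
      cases Sum.inl_injective hxe
      exact M.p_mem i j ((List.mem_cons.1 h).resolve_left e) k hx
  q_mem i j h k hk := by
    by_cases e : (i, j) = (a, b)
    · rw [if_pos e] at hk; cases e
      simp only [newSet, Set.mem_union, Set.mem_insert_iff, Set.mem_singleton_iff, Set.mem_range,
        Sum.inl.injEq, M.q_inj.eq_iff, (M.p_ne_q _ _).symm] at hk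
      simpa using hk
    · rw [if_neg e] at hk
      obtain ⟨x, hx, hxe⟩ := hk
      cases Sum.inl_injective hxe
      exact M.q_mem i j ((List.mem_cons.1 h).resolve_left e) k hx
  disj i j k l h h' hik hjl := by
    have main : ∀ k l, (k, l) ∈ T → a ≠ k → b ≠ l →
        Disjoint (newSet (M.p a) (M.q b) t) (Sum.inl '' M.S k l) := by
      intro k l hkl hak hbl
      rw [Set.disjoint_right]
      rintro _ ⟨x, hx, rfl⟩ hx'
      simp only [newSet, Set.mem_union, Set.mem_insert_iff, Set.mem_singleton_iff, Set.mem_range,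
        Sum.inl.injEq, reduceCtorEq, exists_false, or_false] at hx'
      rcases hx' with rfl | rfl
      · exact hak (M.p_mem k l hkl a hx)
      · exact hbl (M.q_mem k l hkl b hx)
    by_cases e : (i, j) = (a, b) <;> by_cases e' : (k, l) = (a, b)
    · exact absurd (congrArg Prod.fst (e.trans e'.symm)) hik
    · rw [if_pos e, if_neg e']
      cases e
      exact main k l ((List.mem_cons.1 h').resolve_left e') hik hjl
    · rw [if_neg e, if_pos e']
      cases e'
      exact (main i j ((List.mem_cons.1 h).resolve_left e) hik.symm hjl.symm).symm
    · rw [if_neg e, if_neg e']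
      exact (Set.disjoint_image_iff Sum.inl_injective).2
        (M.disj i j k l ((List.mem_cons.1 h).resolve_left e)
          ((List.mem_cons.1 h').resolve_left e') hik hjl)

/-- The empty model on six of the vertices of a long added path. -/
def Model.nil {V : Type*} {t : ℕ} (G : SimpleGraph (V ⊕ Fin (t + 6))) : Model G [] where
  p i := Sum.inr ⟨i, by omega⟩
  q j := Sum.inr ⟨3 + j, by omega⟩
  S _ _ := ∅
  p_inj i j h := by simpa [Fin.ext_iff] using h
  q_inj i j h := by simpa [Fin.ext_iff] using h
  p_ne_q i j h := by
    have := i.isLt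
    simp at h
    omega
  mem := by simp
  chain := by simp
  p_mem := by simp
  q_mem := by simp
  disj := by simp

lemma exists_model (𝒢 : ∀ V : Type, Fintype V → SimpleGraph V → Prop)
    (hne : ∃ (V : Type) (iV : Fintype V) (G : SimpleGraph V),
      𝒢 V iV G ∧ 2 ≤ @Fintype.card V iV)
    (hcl : ClosedUnderPathAddition 𝒢) (T : List (Fin 3 × Fin 3)) :
    ∃ (V : Type) (iV : Fintype V) (G : SimpleGraph V), 𝒢 V iV G ∧ Nonempty (Model G T) := by
  induction T with
  | nil =>
    obtain ⟨V, iV, G, hG, h2⟩ := hne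
    obtain ⟨u, v, huv⟩ := Fintype.one_lt_card_iff.1 h2
    obtain ⟨F, -, hF⟩ := hcl V G hG u v huv (Fintype.card V + 6) (by omega)
    exact ⟨_, _, _, hF, ⟨Model.nil _⟩⟩
  | cons e T ih =>
    obtain ⟨V, iV, G, hG, ⟨M⟩⟩ := ih
    obtain ⟨F, -, hF⟩ := hcl V G hG (M.p e.1) (M.q e.2) (M.p_ne_q _ _) (Fintype.card V) (by omega)
    exact ⟨_, _, _, hF, ⟨M.extend e.1 e.2 _ F⟩⟩

end PathAddPlanar

/-- An isomorphism-closed class of finite simple graphs all of whose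
members are planar, containing a graph with at least two vertices, is not closed under
path-addition. In particular the class of all planar graphs is not closed under
path-addition. -/
theorem planarSubclass_not_closedUnderPathAddition
    (𝒢 : ∀ V : Type, Fintype V → SimpleGraph V → Prop)
    (hiso : IsoClosed 𝒢)
    (hplanar : ∀ (V : Type) (iV : Fintype V) (G : SimpleGraph V),
      𝒢 V iV G → IsPlanarGraph G)
    (hne : ∃ (V : Type) (iV : Fintype V) (G : SimpleGraph V),
      𝒢 V iV G ∧ 2 ≤ @Fintype.card V iV) :
    ¬ ClosedUnderPathAddition 𝒢 := by
  intro hcl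
  obtain ⟨V, iV, G, hG, ⟨M⟩⟩ := PathAddPlanar.exists_model 𝒢 hne hcl
    (List.product (List.finRange 3) (List.finRange 3))
  exact PathAddPlanar.not_planar_of_model M
    (fun e => List.mem_product.2 ⟨List.mem_finRange _, List.mem_finRange _⟩) (hplanar V iV G hG)
end

section
/- The class of 1-planar graphs is not closed under path-addition: there exist a 1-planar finite simple graph G, distinct vertices u, v of G, and a path P of length at least |V(G)|−1 from u to v whose internal vertices are new, such that for every supplementary edge set F the graph G ⊕ P ⊕ F is not 1-planar. -/
/-- The crossings on the edge `e` in the drawing `D`: pairs of an edge `f` and a point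
`p` at which `f` crosses `e`. -/
def Drawing.crossingsOf {V : Type*} {G : SimpleGraph V} (D : Drawing G) (e : Sym2 V) :
    Set (Sym2 V × Plane) :=
  {fp | D.IsCrossingPt e fp.1 fp.2}

/-- A drawing is `k`-planar if every edge is crossed at most `k` times. -/
def Drawing.IsKPlanar {V : Type*} {G : SimpleGraph V} (D : Drawing G) (k : ℕ) : Prop :=
  ∀ e : Sym2 V, (D.crossingsOf e).Finite ∧ (D.crossingsOf e).ncard ≤ k

/-- A graph is `k`-planar if it admits a drawing in which every edge is crossed at most
`k` times. -/
def IsKPlanarGraph {V : Type*} (G : SimpleGraph V) (k : ℕ) : Prop :=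
  ∃ D : Drawing G, D.IsKPlanar k

/-! ### Topological part: nonplanarity of `K₅` -/

theorem aux_lift {A : Type} [TopologicalSpace A] [SimplyConnectedSpace A]
    [LocallyPathConnectedSpace A] (a₀ : A) (F : A → ℂ) (hF : Continuous F) (h0 : ∀ a, F a ≠ 0) :
    ∃ g : A → ℂ, Continuous g ∧ ∀ a, Complex.exp (g a) = F a := by
  obtain ⟨g, hg, -⟩ := Complex.isCoveringMapOn_exp.existsUnique_continuousMap_lifts
    (⟨F, hF⟩ : C(A, ℂ)) (a₀ := a₀) (e₀ := Complex.log (F a₀))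
    (by simp [Complex.exp_log (h0 a₀)]) (fun a => by simpa using h0 a)
  exact ⟨g, g.continuous, fun a => congrFun hg.2 a⟩

theorem aux_unique (g h : ℝ → ℂ) (hg : Continuous g) (hh : Continuous h) (c : ℂ)
    (H : ∀ s, Complex.exp (g s) = c * Complex.exp (h s)) : g 1 - g 0 = h 1 - h 0 := by
  have key : (fun s => g s - h s) = fun _ => g 0 - h 0 := by
    refine Complex.isCoveringMap_exp.eq_of_comp_eq (by fun_prop) (by fun_prop) ?_ 0 rfl
    funext s
    simp only [Function.comp, Subtype.mk.injEq, Complex.exp_sub, H]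
    rw [mul_div_cancel_right₀ _ (Complex.exp_ne_zero _),
      mul_div_cancel_right₀ _ (Complex.exp_ne_zero _)]
  have : g 1 - h 1 = g 0 - h 0 := congrFun key 1
  linear_combination this

theorem aux_rect (α β g₁ g₂ h₁ h₂ : ℝ → ℂ) (hα : Continuous α) (hβ : Continuous β)
    (cg₁ : Continuous g₁) (cg₂ : Continuous g₂) (ch₁ : Continuous h₁) (ch₂ : Continuous h₂)
    (hne : ∀ s t, α s ≠ β t)
    (eg₁ : ∀ s, Complex.exp (g₁ s) = α s - β 0) (eg₂ : ∀ s, Complex.exp (g₂ s) = α s - β 1)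
    (eh₁ : ∀ s, Complex.exp (h₁ s) = β s - α 0) (eh₂ : ∀ s, Complex.exp (h₂ s) = β s - α 1) :
    (g₁ 1 - g₁ 0) - (g₂ 1 - g₂ 0) = (h₁ 1 - h₁ 0) - (h₂ 1 - h₂ 0) := by
  obtain ⟨l, cl, el⟩ := aux_lift (0 : ℝ × ℝ) (fun x => α x.1 - β x.2) (by fun_prop)
    (fun x => sub_ne_zero.2 (hne _ _))
  have e1 := aux_unique g₁ (fun s => l (s, 0)) cg₁ (by fun_prop) 1 (by intro s; simp [eg₁, el])
  have e2 := aux_unique g₂ (fun s => l (s, 1)) cg₂ (by fun_prop) 1 (by intro s; simp [eg₂, el])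
  have e3 := aux_unique h₁ (fun s => l (0, s)) ch₁ (by fun_prop) (-1) (by intro s; simp [eh₁, el])
  have e4 := aux_unique h₂ (fun s => l (1, s)) ch₂ (by fun_prop) (-1) (by intro s; simp [eh₂, el])
  rw [e1, e2, e3, e4]; ring

/-- In every drawing of `K₅` some two independent edges meet. -/
theorem aux_K5 (p : Fin 5 → ℂ) (hp : Function.Injective p) (f : Fin 5 → Fin 5 → ℝ → ℂ)
    (hf : ∀ a b, a < b → Continuous (f a b))
    (f0 : ∀ a b, a < b → f a b 0 = p a) (f1 : ∀ a b, a < b → f a b 1 = p b)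
    (hd : ∀ a b c d, a < b → c < d → a ≠ c → a ≠ d → b ≠ c → b ≠ d →
      ∀ s t, f a b s ≠ f c d t) : False := by
  have off : ∀ a b c, a < b → c ≠ a → c ≠ b → ∀ s, f a b s ≠ p c := by
    intro a b c hab hca hcb s
    have : ∃ d : Fin 5, d ≠ a ∧ d ≠ b ∧ d ≠ c := by
      revert a b c; decide
    obtain ⟨d, hda, hdb, hdc⟩ := this
    rcases lt_or_gt_of_ne hdc with h | h
    · rw [← f1 d c h]; exact hd _ _ _ _ hab h hda.symm hca.symm hdb.symm hcb.symm _ _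
    · rw [← f0 c d h]; exact hd _ _ _ _ hab h hca.symm hda.symm hcb.symm hdb.symm _ _
  have lift : ∀ a b c, ∃ g : ℝ → ℂ, a < b → c ≠ a → c ≠ b →
      Continuous g ∧ ∀ s, Complex.exp (g s) = f a b s - p c := by
    intro a b c
    by_cases h : a < b ∧ c ≠ a ∧ c ≠ b
    · obtain ⟨g, hg⟩ := aux_lift (0 : ℝ) (fun s => f a b s - p c)
        ((hf a b h.1).sub continuous_const) (fun s => sub_ne_zero.2 (off a b c h.1 h.2.1 h.2.2 s))
      exact ⟨g, fun _ _ _ => hg⟩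
    · exact ⟨0, fun h1 h2 h3 => (h ⟨h1, h2, h3⟩).elim⟩
  choose g hg using lift
  let A : Fin 5 → Fin 5 → ℂ := fun x y =>
    if x < y then Complex.log (p x - p y) else Complex.log (p y - p x) + Real.pi * Complex.I
  let sg : Fin 5 → Fin 5 → ℤ := fun x y => if x < y then -1 else 1
  have hA : ∀ x y, x ≠ y → A x y - A y x = Real.pi * Complex.I * (sg x y : ℂ) := by
    intro x y hxy
    rcases lt_or_gt_of_ne hxy with h | h
    · simp [A, sg, h, h.not_gt]
    · simp [A, sg, h, h.not_gt]
  have eA : ∀ x y, x ≠ y → Complex.exp (A x y) = p x - p y := by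
    intro x y hxy
    have hne : p x - p y ≠ 0 := sub_ne_zero.2 (hp.ne hxy)
    have hne' : p y - p x ≠ 0 := sub_ne_zero.2 (hp.ne hxy.symm)
    by_cases h : x < y
    · simp [A, h, Complex.exp_log hne]
    · simp [A, h, Complex.exp_add, Complex.exp_log hne']
  have hn : ∀ a b c, ∃ n : ℤ, a < b → c ≠ a → c ≠ b →
      g a b c 1 - g a b c 0 = A b c - A a c + n * (2 * Real.pi * Complex.I) := by
    intro a b c
    by_cases h : a < b ∧ c ≠ a ∧ c ≠ b
    · obtain ⟨h1, h2, h3⟩ := h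
      obtain ⟨-, e⟩ := hg a b c h1 h2 h3
      have : Complex.exp (g a b c 1 - g a b c 0) = Complex.exp (A b c - A a c) := by
        rw [Complex.exp_sub, Complex.exp_sub, e, e, eA _ _ h3.symm, eA _ _ h2.symm,
          f0 _ _ h1, f1 _ _ h1]
      obtain ⟨n, hn⟩ := Complex.exp_eq_exp_iff_exists_int.1 this
      exact ⟨n, fun _ _ _ => hn⟩
    · exact ⟨0, fun h1 h2 h3 => (h ⟨h1, h2, h3⟩).elim⟩
  choose n hn using hn
  have eqn : ∀ a b c d, a < b → c < d → a ≠ c → a ≠ d → b ≠ c → b ≠ d →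
      sg b c - sg a c - sg b d + sg a d = 2 * (n c d a - n c d b - n a b c + n a b d) := by
    intro a b c d hab hcd hac had hbc hbd
    have R := aux_rect (f a b) (f c d) (g a b c) (g a b d) (g c d a) (g c d b)
      (hf _ _ hab) (hf _ _ hcd) (hg _ _ _ hab hac.symm hbc.symm).1
      (hg _ _ _ hab had.symm hbd.symm).1 (hg _ _ _ hcd hac had).1 (hg _ _ _ hcd hbc hbd).1
      (hd _ _ _ _ hab hcd hac had hbc hbd)
      (by rw [f0 _ _ hcd]; exact (hg _ _ _ hab hac.symm hbc.symm).2)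
      (by rw [f1 _ _ hcd]; exact (hg _ _ _ hab had.symm hbd.symm).2)
      (by rw [f0 _ _ hab]; exact (hg _ _ _ hcd hac had).2)
      (by rw [f1 _ _ hab]; exact (hg _ _ _ hcd hbc hbd).2)
    rw [hn _ _ _ hab hac.symm hbc.symm, hn _ _ _ hab had.symm hbd.symm, hn _ _ _ hcd hac had,
      hn _ _ _ hcd hbc hbd] at R
    have hpi : (Real.pi * Complex.I : ℂ) ≠ 0 :=
      mul_ne_zero (by exact_mod_cast Real.pi_ne_zero) Complex.I_ne_zero
    have : (Real.pi * Complex.I : ℂ) * ((sg b c - sg a c - sg b d + sg a d : ℤ) : ℂ) =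
        (Real.pi * Complex.I : ℂ) * ((2 * (n c d a - n c d b - n a b c + n a b d) : ℤ) : ℂ) := by
      push_cast
      linear_combination R - hA b c hbc + hA a c hac + hA b d hbd - hA a d had
    exact_mod_cast mul_left_cancel₀ hpi this
  have E1 := eqn 0 1 2 3 (by decide) (by decide) (by decide) (by decide) (by decide) (by decide)
  have E2 := eqn 0 2 1 3 (by decide) (by decide) (by decide) (by decide) (by decide) (by decide)
  have E3 := eqn 0 3 1 2 (by decide) (by decide) (by decide) (by decide) (by decide) (by decide)
  have E4 := eqn 0 1 2 4 (by decide) (by decide) (by decide) (by decide) (by decide) (by decide)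
  have E5 := eqn 0 2 1 4 (by decide) (by decide) (by decide) (by decide) (by decide) (by decide)
  have E6 := eqn 0 4 1 2 (by decide) (by decide) (by decide) (by decide) (by decide) (by decide)
  have E7 := eqn 0 1 3 4 (by decide) (by decide) (by decide) (by decide) (by decide) (by decide)
  have E8 := eqn 0 3 1 4 (by decide) (by decide) (by decide) (by decide) (by decide) (by decide)
  have E9 := eqn 0 4 1 3 (by decide) (by decide) (by decide) (by decide) (by decide) (by decide)
  have E10 := eqn 0 2 3 4 (by decide) (by decide) (by decide) (by decide) (by decide) (by decide)
  have E11 := eqn 0 3 2 4 (by decide) (by decide) (by decide) (by decide) (by decide) (by decide)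
  have E12 := eqn 0 4 2 3 (by decide) (by decide) (by decide) (by decide) (by decide) (by decide)
  have E13 := eqn 1 2 3 4 (by decide) (by decide) (by decide) (by decide) (by decide) (by decide)
  have E14 := eqn 1 3 2 4 (by decide) (by decide) (by decide) (by decide) (by decide) (by decide)
  have E15 := eqn 1 4 2 3 (by decide) (by decide) (by decide) (by decide) (by decide) (by decide)
  clear eqn hn hA eA hg hd off hf f0 f1
  simp [sg] at E1 E2 E3 E4 E5 E6 E7 E8 E9 E10 E11 E12 E13 E14 E15
  omega

/-- The version of `aux_K5` used below, phrased with sets in which the endpoints are joined. -/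
theorem aux_K5_joined (p : Fin 5 → ℝ × ℝ) (hp : Function.Injective p)
    (S : Fin 5 × Fin 5 → Set (ℝ × ℝ))
    (hS : ∀ a b, a < b → JoinedIn (S (a, b)) (p a) (p b))
    (hd : ∀ a b c d, a < b → c < d → a ≠ c → a ≠ d → b ≠ c → b ≠ d →
      Disjoint (S (a, b)) (S (c, d))) : False := by
  have h : ∀ a b, ∃ f : ℝ → ℝ × ℝ, a < b →
      Continuous f ∧ f 0 = p a ∧ f 1 = p b ∧ ∀ s, f s ∈ S (a, b) := by
    intro a b
    by_cases hab : a < b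
    · obtain ⟨γ, hγ⟩ := hS a b hab
      refine ⟨γ.extend, fun _ => ⟨γ.continuous_extend, γ.extend_zero, γ.extend_one, fun s => ?_⟩⟩
      exact hγ _
    · exact ⟨0, fun h => (hab h).elim⟩
  choose f hf using h
  let φ := Complex.equivRealProdCLM.symm
  refine aux_K5 (fun a => φ (p a)) (φ.injective.comp hp) (fun a b s => φ (f a b s)) ?_ ?_ ?_ ?_
  · intro a b hab
    exact φ.continuous.comp (hf a b hab).1
  · intro a b hab; simp only [(hf a b hab).2.1]
  · intro a b hab; simp only [(hf a b hab).2.2.1]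
  · intro a b c d hab hcd h1 h2 h3 h4 s t h
    have h := φ.injective h
    exact Set.disjoint_left.1 (hd a b c d hab hcd h1 h2 h3 h4) ((hf a b hab).2.2.2 s)
      (h ▸ (hf c d hcd).2.2.2 t)

/-! ### Combinatorial part -/

/-- The (closed) image of an edge. -/
def Drawing.im {V : Type*} {G : SimpleGraph V} (D : Drawing G) (e : Sym2 V) : Set Plane :=
  D.curve e '' Set.Icc 0 1

/-- Restriction of a drawing along an injective homomorphism. -/
def Drawing.restr {V W : Type*} {G : SimpleGraph V} {H : SimpleGraph W} (D : Drawing H)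
    (ι : V → W) (hι : Function.Injective ι) (hom : ∀ a b, G.Adj a b → H.Adj (ι a) (ι b)) :
    Drawing G :=
  have hE : ∀ e ∈ G.edgeSet, Sym2.map ι e ∈ H.edgeSet := by
    intro e; induction e with | _ a b => exact hom a b
  { pos := fun x => D.pos (ι x)
    curve := fun e => D.curve (Sym2.map ι e)
    pos_inj := D.pos_inj.comp hι
    curve_cont := fun e he => D.curve_cont _ (hE e he)
    curve_inj := fun e he => D.curve_inj _ (hE e he)
    curve_ends := fun x y h => D.curve_ends _ _ (hom x y h)
    no_vertex_interior := fun e he s hs x => D.no_vertex_interior _ (hE e he) s hs _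
    finite_meets := fun e he f hf hef =>
      D.finite_meets _ (hE e he) _ (hE f hf) ((Sym2.map.injective hι).ne hef)
    shared_endpoint := fun e he f hf hef x hxe hxf =>
      D.shared_endpoint _ (hE e he) _ (hE f hf) ((Sym2.map.injective hι).ne hef) (ι x)
        (Sym2.mem_map.2 ⟨x, hxe, rfl⟩) (Sym2.mem_map.2 ⟨x, hxf, rfl⟩) }

theorem aux_restr_crossing {V W : Type*} {G : SimpleGraph V} {H : SimpleGraph W} (D : Drawing H)
    (ι : V → W) (hι : Function.Injective ι) (hom : ∀ a b, G.Adj a b → H.Adj (ι a) (ι b))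
    {e f : Sym2 V} {p : Plane} (h : (D.restr ι hι hom).IsCrossingPt e f p) :
    D.IsCrossingPt (Sym2.map ι e) (Sym2.map ι f) p := by
  have hE : ∀ e ∈ G.edgeSet, Sym2.map ι e ∈ H.edgeSet := by
    intro e; induction e with | _ a b => exact hom a b
  obtain ⟨h1, h2, h3, h4, h5⟩ := h
  exact ⟨hE _ h1, hE _ h2, (Sym2.map.injective hι).ne h3, h4, h5⟩

theorem aux_restr_planar {V W : Type*} {G : SimpleGraph V} {H : SimpleGraph W} (D : Drawing H)
    (ι : V → W) (hι : Function.Injective ι) (hom : ∀ a b, G.Adj a b → H.Adj (ι a) (ι b))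
    {k : ℕ} (hD : D.IsKPlanar k) : (D.restr ι hι hom).IsKPlanar k := by
  intro e
  obtain ⟨hfin, hcard⟩ := hD (Sym2.map ι e)
  have inj : Function.Injective (fun x : Sym2 V × Plane => (Sym2.map ι x.1, x.2)) := by
    rintro ⟨a, b⟩ ⟨c, d⟩ h
    simp only [Prod.mk.injEq] at h
    exact Prod.ext (Sym2.map.injective hι h.1) h.2
  have sub : (fun x : Sym2 V × Plane => (Sym2.map ι x.1, x.2)) ''
      (D.restr ι hι hom).crossingsOf e ⊆ D.crossingsOf (Sym2.map ι e) := by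
    rintro _ ⟨x, hx, rfl⟩
    exact aux_restr_crossing D ι hι hom hx
  have fin' := (hfin.subset sub).of_finite_image inj.injOn
  refine ⟨fin', ?_⟩
  rw [← Set.ncard_image_of_injective _ inj]
  exact (Set.ncard_le_ncard sub hfin).trans hcard

/-- In a 1-planar drawing an edge is crossed by at most one edge. -/
theorem aux_unique_cross {V : Type*} {G : SimpleGraph V} (D : Drawing G) (hD : D.IsKPlanar 1)
    {e f f' : Sym2 V} (h : D.Crosses e f) (h' : D.Crosses e f') : f = f' := by
  obtain ⟨p, hp⟩ := h
  obtain ⟨p', hp'⟩ := h'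
  have := (Set.ncard_le_one (hD e).1).1 (hD e).2 (f, p) hp (f', p') hp'
  exact congrArg Prod.fst this

theorem aux_ends {V : Type*} {G : SimpleGraph V} (D : Drawing G) {e : Sym2 V}
    (he : e ∈ G.edgeSet) {s : ℝ} (hs : s = 0 ∨ s = 1) : ∃ x ∈ e, D.curve e s = D.pos x := by
  induction e with
  | _ a b =>
    have h := D.curve_ends a b he
    have : D.curve s(a, b) s ∈ ({D.pos a, D.pos b} : Set Plane) := by
      rw [← h]; rcases hs with rfl | rfl <;> simp
    rcases this with h | h
    · exact ⟨a, by simp, h⟩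
    · exact ⟨b, by simp, h⟩

/-- A point of an edge is an interior point, or one of its endpoints. -/
theorem aux_mem_im {V : Type*} {G : SimpleGraph V} (D : Drawing G) {e : Sym2 V}
    (he : e ∈ G.edgeSet) {q : Plane} (hq : q ∈ D.im e) :
    (∃ x ∈ e, q = D.pos x) ∨ ((∃ s ∈ Set.Ioo (0 : ℝ) 1, D.curve e s = q) ∧ ∀ x, q ≠ D.pos x) := by
  obtain ⟨s, hs, rfl⟩ := hq
  rcases eq_or_lt_of_le hs.1 with h | h
  · exact Or.inl (aux_ends D he (Or.inl h.symm))
  rcases eq_or_lt_of_le hs.2 with h' | h'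
  · exact Or.inl (aux_ends D he (Or.inr h'))
  · exact Or.inr ⟨⟨s, ⟨h, h'⟩, rfl⟩, fun x => D.no_vertex_interior e he s ⟨h, h'⟩ x⟩

theorem aux_pos_mem {V : Type*} {G : SimpleGraph V} (D : Drawing G) {e : Sym2 V}
    (he : e ∈ G.edgeSet) {x : V} (hq : D.pos x ∈ D.im e) : x ∈ e := by
  rcases aux_mem_im D he hq with ⟨y, hy, h⟩ | ⟨-, h⟩
  · rwa [D.pos_inj h]
  · exact (h x rfl).elim

theorem aux_joined_edge {V : Type*} {G : SimpleGraph V} (D : Drawing G) {x y : V}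
    (h : G.Adj x y) : JoinedIn (D.im s(x, y)) (D.pos x) (D.pos y) := by
  have hj : JoinedIn (D.im s(x, y)) (D.curve s(x, y) 0) (D.curve s(x, y) 1) :=
    JoinedIn.ofLine (D.curve_cont _ h) rfl rfl le_rfl
  have hends := D.curve_ends x y h
  have hne : D.pos x ≠ D.pos y := D.pos_inj.ne h.ne
  rcases Set.pair_eq_pair_iff.1 hends with ⟨h0, h1⟩ | ⟨h0, h1⟩
  · rwa [h0, h1] at hj
  · rw [h0, h1] at hj; exact hj.symm

/-- Good sets: the two terminals are joined in `S` which avoids the old graph. -/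
def GoodSet {V W : Type} (G : SimpleGraph V) (u v : V) {H : SimpleGraph W} (D : Drawing H)
    (ι : V → W) (S : Set Plane) : Prop :=
  JoinedIn S (D.pos (ι u)) (D.pos (ι v)) ∧ (S ⊆ ⋃ e ∈ H.edgeSet, D.im e) ∧
  (∀ c, c ≠ u → c ≠ v → D.pos (ι c) ∉ S) ∧
  ∀ e ∈ G.edgeSet, ∀ q ∈ S, q ∈ D.im (Sym2.map ι e) → q = D.pos (ι u) ∨ q = D.pos (ι v)

/-- Closure of 1-planar graphs under path-addition. -/
def PathClosed : Prop :=
  ∀ (V : Type) (iV : Fintype V) (G : SimpleGraph V), IsKPlanarGraph G 1 →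
      ∀ u v : V, u ≠ v → ∀ t : ℕ, @Fintype.card V iV - 1 ≤ t + 1 →
          ∃ F : Set (Sym2 (V ⊕ Fin t)), IsKPlanarGraph (pathAdd G u v t F) 1

theorem aux_chain_mem {V : Type} {u v x : V} {t : ℕ} (ht : 1 ≤ t) {f : Sym2 (V ⊕ Fin t)}
    (hf : f ∈ chainEdges (Sum.inl u) (Sum.inl v) (fun i : Fin t => (Sum.inr i : V ⊕ Fin t))) :
    (Sum.inl x ∈ f → x = u ∨ x = v) ∧ ∃ i, Sum.inr i ∈ f := by
  obtain ⟨i, rfl⟩ := hf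
  constructor
  · intro h
    rcases Sym2.mem_iff.1 h with h | h <;> unfold chainVertex at h <;> split_ifs at h <;> simp_all
  · by_cases h0 : (i : ℕ) = 0
    · refine ⟨⟨0, by omega⟩, Sym2.mem_iff.2 (Or.inr ?_)⟩
      have : ¬ t = 0 := by omega
      simp [chainVertex, h0, this]
    · have := i.isLt
      refine ⟨⟨(i : ℕ) - 1, by omega⟩, Sym2.mem_iff.2 (Or.inl ?_)⟩
      have h2 : ¬ (i : ℕ) = t + 1 := by omega
      have h3 : i ≠ 0 := fun h => h0 (by simp [h])
      simp [chainVertex, h2, h3]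

theorem aux_chain_edge {V : Type} {G : SimpleGraph V} {u v : V} {t : ℕ} (ht : 1 ≤ t)
    (F : Set (Sym2 (V ⊕ Fin t))) {f : Sym2 (V ⊕ Fin t)}
    (hf : f ∈ chainEdges (Sum.inl u) (Sum.inl v) (fun i : Fin t => (Sum.inr i : V ⊕ Fin t))) :
    f ∈ (pathAdd G u v t F).edgeSet := by
  unfold pathAdd
  rw [SimpleGraph.edgeSet_fromEdgeSet]
  refine ⟨Or.inl (Or.inr hf), ?_⟩
  obtain ⟨i, rfl⟩ := hf
  have := i.isLt
  show ¬ Sym2.IsDiag _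
  rw [Sym2.mk_isDiag_iff]
  simp only [chainVertex, Fin.val_castSucc, Fin.val_succ]
  split_ifs <;> simp <;> omega

theorem aux_chain_joined {V : Type} {G : SimpleGraph V} {u v : V} {t : ℕ} (ht : 1 ≤ t)
    (F : Set (Sym2 (V ⊕ Fin t))) (D : Drawing (pathAdd G u v t F)) :
    JoinedIn (⋃ f ∈ chainEdges (Sum.inl u) (Sum.inl v)
      (fun i : Fin t => (Sum.inr i : V ⊕ Fin t)), D.im f) (D.pos (Sum.inl u))
      (D.pos (Sum.inl v)) := by
  set S := ⋃ f ∈ chainEdges (Sum.inl u) (Sum.inl v)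
      (fun i : Fin t => (Sum.inr i : V ⊕ Fin t)), D.im f with hS
  set c := chainVertex (Sum.inl u) (Sum.inl v) (fun i : Fin t => (Sum.inr i : V ⊕ Fin t)) with hc
  have step : ∀ i : Fin (t + 1), JoinedIn S (D.pos (c i.castSucc)) (D.pos (c i.succ)) := by
    intro i
    have hm : s(c i.castSucc, c i.succ) ∈ chainEdges (Sum.inl u) (Sum.inl v)
      (fun i : Fin t => (Sum.inr i : V ⊕ Fin t)) := ⟨i, rfl⟩
    have hadj : (pathAdd G u v t F).Adj (c i.castSucc) (c i.succ) := aux_chain_edge ht F hm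
    exact (aux_joined_edge D hadj).mono (Set.subset_biUnion_of_mem (u := fun f => D.im f) hm)
  have h0 : c 0 = Sum.inl u := by simp [hc, chainVertex]
  have hl : c (Fin.last (t + 1)) = Sum.inl v := by simp [hc, chainVertex]
  have all : ∀ i : Fin (t + 2), JoinedIn S (D.pos (c 0)) (D.pos (c i)) := by
    intro i
    induction i using Fin.induction with
    | zero => exact JoinedIn.refl (step 0).source_mem
    | succ i ih => exact ih.trans (step i)
  have := all (Fin.last (t + 1))
  rwa [h0, hl] at this

theorem aux_inl_adj {V : Type} {G : SimpleGraph V} {u v : V} {t : ℕ}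
    (F : Set (Sym2 (V ⊕ Fin t))) (a b : V) (h : G.Adj a b) :
    (pathAdd G u v t F).Adj (Sum.inl a) (Sum.inl b) := by
  unfold pathAdd
  rw [SimpleGraph.fromEdgeSet_adj]
  exact ⟨Or.inl (Or.inl ⟨s(a, b), h, rfl⟩), by simpa using h.ne⟩

theorem aux_free_step (hcl : PathClosed) {V : Type} [Fintype V] (G : SimpleGraph V)
    (hG : IsKPlanarGraph G 1) {u v : V} (huv : u ≠ v) (k : ℕ) :
    ∃ (W : Type) (_ : Fintype W) (H : SimpleGraph W) (ι : V → W), Function.Injective ι ∧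
      (∀ a b, G.Adj a b → H.Adj (ι a) (ι b)) ∧ IsKPlanarGraph H 1 ∧
      ∀ D : Drawing H, D.IsKPlanar 1 → (∃ S, GoodSet G u v D ι S) ∨
        ∃ T : Finset (Sym2 V), T.card = k ∧ ∀ e ∈ T, ∃ f, D.Crosses (Sym2.map ι e) f := by
  classical
  induction k with
  | zero =>
    exact ⟨V, inferInstance, G, id, Function.injective_id, fun _ _ h => h, hG,
      fun D _ => Or.inr ⟨∅, rfl, by simp⟩⟩
  | succ k ih =>
    obtain ⟨W, iW, H, ι, hι, hom, hH, hP⟩ := ih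
    obtain ⟨F, hF⟩ := hcl W iW H hH (ι u) (ι v) (hι.ne huv) (Fintype.card W + 1) (by omega)
    have ht : 1 ≤ Fintype.card W + 1 := by omega
    generalize Fintype.card W + 1 = t at F hF ht
    have hE : ∀ e ∈ G.edgeSet, Sym2.map (Sum.inl ∘ ι) e ∈ (pathAdd H (ι u) (ι v) t F).edgeSet := by
      intro e; induction e with | _ a b => exact fun h => aux_inl_adj F _ _ (hom a b h)
    have hE' : ∀ e ∈ H.edgeSet, Sym2.map Sum.inl e ∈ (pathAdd H (ι u) (ι v) t F).edgeSet := by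
      intro e; induction e with | _ a b => exact fun h => aux_inl_adj F _ _ h
    refine ⟨W ⊕ Fin t, inferInstance, pathAdd H (ι u) (ι v) t F, Sum.inl ∘ ι,
      Sum.inl_injective.comp hι, fun a b h => aux_inl_adj F _ _ (hom a b h), hF, ?_⟩
    intro D hD
    rcases hP (D.restr Sum.inl Sum.inl_injective (aux_inl_adj F))
      (aux_restr_planar D _ _ _ hD) with ⟨S, hS1, hS2, hS3, hS4⟩ | ⟨T, hTc, hT⟩
    · refine Or.inl ⟨S, hS1, fun q hq => ?_, hS3, ?_⟩
      · obtain ⟨e, he, hqe⟩ := Set.mem_iUnion₂.1 (hS2 hq)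
        exact Set.mem_iUnion₂.2 ⟨_, hE' e he, hqe⟩
      · intro e he q hq hqe
        rw [← Sym2.map_map] at hqe
        exact hS4 e he q hq hqe
    set C := chainEdges (Sum.inl (ι u)) (Sum.inl (ι v))
      (fun i : Fin t => (Sum.inr i : W ⊕ Fin t)) with hC
    by_cases hcr : ∃ e ∈ G.edgeSet, ∃ f ∈ C, D.Crosses (Sym2.map (Sum.inl ∘ ι) e) f
    · obtain ⟨e, he, f, hf, hef⟩ := hcr
      have old : ∀ e ∈ T, ∃ f, D.Crosses (Sym2.map (Sum.inl ∘ ι) e) (Sym2.map Sum.inl f) := by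
        intro e he
        obtain ⟨f, p, hp⟩ := hT e he
        refine ⟨f, p, ?_⟩
        have := aux_restr_crossing D _ _ _ hp
        rwa [Sym2.map_map] at this
      refine Or.inr ⟨insert e T, ?_, ?_⟩
      · rw [Finset.card_insert_of_notMem, hTc]
        intro heT
        obtain ⟨f', hf'⟩ := old e heT
        have := aux_unique_cross D hD hef hf'
        obtain ⟨i, hi⟩ := (aux_chain_mem (x := ι u) ht hf).2
        rw [this] at hi
        simp [Sym2.mem_map] at hi
      · intro e' he'
        rcases Finset.mem_insert.1 he' with rfl | h
        · exact ⟨f, hef⟩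
        · obtain ⟨f', hf'⟩ := old e' h
          exact ⟨_, hf'⟩
    · push Not at hcr
      refine Or.inl ⟨⋃ f ∈ C, D.im f, aux_chain_joined ht F D, ?_, ?_, ?_⟩
      · intro q hq
        obtain ⟨f, hf, hqf⟩ := Set.mem_iUnion₂.1 hq
        exact Set.mem_iUnion₂.2 ⟨f, aux_chain_edge ht F hf, hqf⟩
      · intro c hcu hcv hq
        obtain ⟨f, hf, hqf⟩ := Set.mem_iUnion₂.1 hq
        have h1 := aux_pos_mem D (aux_chain_edge ht F hf) hqf
        rcases (aux_chain_mem ht hf).1 h1 with h | h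
        · exact hcu (hι h)
        · exact hcv (hι h)
      · intro e he q hq hqe
        obtain ⟨f, hf, hqf⟩ := Set.mem_iUnion₂.1 hq
        have hfE := aux_chain_edge (G := H) ht F hf
        rcases aux_mem_im D (hE e he) hqe with ⟨x, hx, rfl⟩ | ⟨hint, hnv⟩
        · have h1 := aux_pos_mem D hfE hqf
          obtain ⟨y, -, rfl⟩ := Sym2.mem_map.1 hx
          rcases (aux_chain_mem ht hf).1 h1 with h | h
          · left; rw [Function.comp, h]; rfl
          · right; rw [Function.comp, h]; rfl
        · rcases aux_mem_im D hfE hqf with ⟨x, -, rfl⟩ | ⟨hint', -⟩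
          · exact (hnv x rfl).elim
          · refine (hcr e he f hf ⟨q, hE e he, hfE, ?_, hint, hint'⟩).elim
            rintro rfl
            obtain ⟨i, hi⟩ := (aux_chain_mem (x := ι u) ht hf).2
            simp [Sym2.mem_map] at hi

theorem aux_free (hcl : PathClosed) {V : Type} [Fintype V] (G : SimpleGraph V)
    (hG : IsKPlanarGraph G 1) {u v : V} (huv : u ≠ v) :
    ∃ (W : Type) (_ : Fintype W) (H : SimpleGraph W) (ι : V → W), Function.Injective ι ∧
      (∀ a b, G.Adj a b → H.Adj (ι a) (ι b)) ∧ IsKPlanarGraph H 1 ∧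
      ∀ D : Drawing H, D.IsKPlanar 1 → ∃ S, GoodSet G u v D ι S := by
  classical
  obtain ⟨W, iW, H, ι, hι, hom, hH, hP⟩ :=
    aux_free_step hcl G hG huv (Fintype.card (Sym2 V) + 1)
  refine ⟨W, iW, H, ι, hι, hom, hH, fun D hD => ?_⟩
  rcases hP D hD with h | ⟨T, hT, -⟩
  · exact h
  · have := T.card_le_univ
    omega

theorem aux_build (hcl : PathClosed) (L : Finset (Fin 5 × Fin 5)) (hL : ∀ e ∈ L, e.1 ≠ e.2) :
    ∃ (V : Type) (_ : Fintype V) (G : SimpleGraph V) (p : Fin 5 → V), Function.Injective p ∧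
      IsKPlanarGraph G 1 ∧ ∀ D : Drawing G, D.IsKPlanar 1 →
      ∃ S : Fin 5 × Fin 5 → Set Plane,
        (∀ e ∈ L, JoinedIn (S e) (D.pos (p e.1)) (D.pos (p e.2))) ∧
        (∀ e ∈ L, S e ⊆ ⋃ f ∈ G.edgeSet, D.im f) ∧
        (∀ e ∈ L, ∀ c, c ≠ e.1 → c ≠ e.2 → D.pos (p c) ∉ S e) ∧
        ∀ e ∈ L, ∀ f ∈ L, e.1 ≠ f.1 → e.1 ≠ f.2 → e.2 ≠ f.1 → e.2 ≠ f.2 →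
          Disjoint (S e) (S f) := by
  classical
  induction L using Finset.induction_on with
  | empty =>
    refine ⟨Fin 5, inferInstance, ⊥, id, Function.injective_id, ?_, ?_⟩
    · refine ⟨{ pos := fun i => ((i : ℕ), 0), curve := fun _ _ => 0, pos_inj := ?_,
                curve_cont := by simp, curve_inj := by simp, curve_ends := by simp,
                no_vertex_interior := by simp, finite_meets := by simp,
                shared_endpoint := by simp }, ?_⟩
      · intro i j h
        simp only [Prod.mk.injEq, and_true, Nat.cast_inj] at h
        exact Fin.ext h
      · intro e
        simp [Drawing.crossingsOf, Drawing.IsCrossingPt]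
    · intro D _
      exact ⟨fun _ => ∅, by simp, by simp, by simp, by simp⟩
  | insert e L heL ih =>
    obtain ⟨V, iV, G, p, hp, hG, hP⟩ := ih (fun f hf => hL f (Finset.mem_insert_of_mem hf))
    have hne : e.1 ≠ e.2 := hL e (Finset.mem_insert_self _ _)
    obtain ⟨W, iW, H, ι, hι, hom, hH, hQ⟩ := aux_free hcl G hG (hp.ne hne)
    have hE : ∀ e ∈ G.edgeSet, Sym2.map ι e ∈ H.edgeSet := by
      intro e; induction e with | _ a b => exact hom a b
    refine ⟨W, iW, H, ι ∘ p, hι.comp hp, hH, fun D hD => ?_⟩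
    obtain ⟨S', hS1, hS2, hS3, hS4⟩ := hQ D hD
    obtain ⟨S, hT1, hT2, hT3, hT4⟩ := hP (D.restr ι hι hom) (aux_restr_planar D _ _ _ hD)
    have hSe : ∀ f ∈ L, Function.update S e S' f = S f := fun f hf =>
      Function.update_of_ne (ne_of_mem_of_not_mem hf heL) _ _
    have hdis : ∀ f ∈ L, e.1 ≠ f.1 → e.1 ≠ f.2 → e.2 ≠ f.1 → e.2 ≠ f.2 →
        Disjoint S' (S f) := by
      intro f hf h1 h2 h3 h4
      rw [Set.disjoint_left]
      intro q hq hqf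
      obtain ⟨g, hg, hqg⟩ := Set.mem_iUnion₂.1 (hT2 f hf hqf)
      rcases hS4 g hg q hq hqg with h | h
      · exact hT3 f hf _ h1 h2 (h ▸ hqf)
      · exact hT3 f hf _ h3 h4 (h ▸ hqf)
    refine ⟨Function.update S e S', ?_, ?_, ?_, ?_⟩
    · intro f hf
      rcases Finset.mem_insert.1 hf with rfl | hf
      · simpa using hS1
      · rw [hSe f hf]; exact hT1 f hf
    · intro f hf
      rcases Finset.mem_insert.1 hf with rfl | hf
      · simpa using hS2
      · rw [hSe f hf]
        intro q hq
        obtain ⟨g, hg, hqg⟩ := Set.mem_iUnion₂.1 (hT2 f hf hq)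
        exact Set.mem_iUnion₂.2 ⟨_, hE g hg, hqg⟩
    · intro f hf c h1 h2
      rcases Finset.mem_insert.1 hf with rfl | hf
      · rw [Function.update_self]; exact hS3 _ (hp.ne h1) (hp.ne h2)
      · rw [hSe f hf]; exact hT3 f hf c h1 h2
    · intro f hf' g hg' h1 h2 h3 h4
      rcases Finset.mem_insert.1 hf' with rfl | hf
      · rcases Finset.mem_insert.1 hg' with rfl | hg
        · exact (h1 rfl).elim
        · rw [Function.update_self, hSe g hg]; exact hdis g hg h1 h2 h3 h4
      · rcases Finset.mem_insert.1 hg' with rfl | hg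
        · rw [Function.update_self, hSe f hf]
          exact (hdis f hf h1.symm h3.symm h2.symm h4.symm).symm
        · rw [hSe g hg, hSe f hf]; exact hT4 f hf g hg h1 h2 h3 h4

theorem aux_not_closed : ¬ PathClosed := by
  intro hcl
  obtain ⟨V, iV, G, p, hp, ⟨D, hD⟩, hP⟩ :=
    aux_build hcl (Finset.univ.filter fun e => e.1 < e.2)
      (fun e he => ((Finset.mem_filter.1 he).2).ne)
  obtain ⟨S, h1, -, -, h4⟩ := hP D hD
  refine aux_K5_joined (fun a => D.pos (p a)) (D.pos_inj.comp hp) S ?_ ?_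
  · intro a b hab
    exact h1 (a, b) (by simpa using hab)
  · intro a b c d hab hcd
    exact h4 (a, b) (by simpa using hab) (c, d) (by simpa using hcd)

/-- The class of 1-planar graphs is not closed under path-addition:
there are a 1-planar graph `G`, distinct vertices `u, v`, and a path of length at least
`|V(G)| - 1` with new internal vertices such that for every supplementary edge set the
resulting graph is not 1-planar. -/
theorem onePlanar_not_closedUnderPathAddition :
    ∃ (V : Type) (iV : Fintype V) (G : SimpleGraph V),
      IsKPlanarGraph G 1 ∧
      ∃ u v : V, u ≠ v ∧
        ∃ t : ℕ, @Fintype.card V iV - 1 ≤ t + 1 ∧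
          ∀ F : Set (Sym2 (V ⊕ Fin t)), ValidSupp F →
            ¬ IsKPlanarGraph (pathAdd G u v t F) 1 := by
  by_contra hcon
  push Not at hcon
  refine aux_not_closed (fun V iV G hG u v huv t ht => ?_)
  obtain ⟨F, -, hF⟩ := hcon V iV G hG u v huv t ht
  exact ⟨F, hF⟩
end

section
/- For every k ≥ 0 and every q ≥ 4k+9, the complete bipartite graph K_{2,q} has the separating cycle property for k-planar drawings: in every drawing of K_{2,q} in which each edge is crossed at most k times, there exist a cycle C of length 4 in K_{2,q} and two vertices x and y of K_{2,q} not on C such that the points of x and y lie in different connected components of the complement in ℝ² of the union of the curves of the four edges of C. -/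
section K33
open unitInterval

/-- Nonvanishing maps on the square have a continuous logarithm. -/
lemma exists_log_lift (F : I × I → ℂ) (hF : Continuous F) (h0 : ∀ a, F a ≠ 0) :
    ∃ g : I × I → ℂ, Continuous g ∧ ∀ a, Complex.exp (g a) = F a := by
  let P : ℝ × ℝ → I × I := fun z =>
    (Set.projIcc 0 1 zero_le_one z.1, Set.projIcc 0 1 zero_le_one z.2)
  have hP : Continuous P := by
    have := continuous_projIcc (a := (0:ℝ)) (b := 1) (h := zero_le_one)
    fun_prop
  obtain ⟨g, ⟨-, hg⟩, -⟩ := Complex.isCoveringMapOn_exp.existsUnique_continuousMap_lifts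
    (⟨F ∘ P, hF.comp hP⟩ : C(ℝ × ℝ, ℂ)) (a₀ := (0, 0)) (e₀ := Complex.log (F (P (0, 0))))
    (by simpa using Complex.exp_log (h0 _)) (fun a => by simpa using h0 _)
  refine ⟨fun z => g (z.1, z.2), by fun_prop, fun a => ?_⟩
  have := congrFun hg (a.1, a.2)
  simpa [P] using this

/-- Two logarithms along a path, of functions differing by a constant factor, have the same
total change. -/
lemma lift_change_eq (g h : I → ℂ) (hg : Continuous g) (hh : Continuous h) (c : ℂ)
    (H : ∀ t, Complex.exp (g t) = c * Complex.exp (h t)) : g 1 - g 0 = h 1 - h 0 := by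
  have key : g = fun t => h t + (g 0 - h 0) := by
    refine Complex.isCoveringMap_exp.eq_of_comp_eq hg (by fun_prop) ?_ 0 (by ring)
    funext t
    apply Subtype.ext
    simp only [Function.comp]
    rw [H t, Complex.exp_add, Complex.exp_sub, H 0]
    field_simp [Complex.exp_ne_zero]
  rw [congrFun key 1]
  ring

/-- `a` is the total change of the logarithm of `f - v` along the path `f`. -/
def IsChange (f : I → ℂ) (v a : ℂ) : Prop :=
  ∀ (g : I → ℂ) (c : ℂ), Continuous g → (∀ t, Complex.exp (g t) = c * (f t - v)) →
    g 1 - g 0 = a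

lemma exists_change (f : I → ℂ) (hf : Continuous f) (v : ℂ) (h : ∀ t, f t ≠ v) :
    ∃ a : ℂ, Complex.exp a * (f 0 - v) = f 1 - v ∧ IsChange f v a := by
  obtain ⟨L, hL, hL'⟩ := exists_log_lift (fun t => f t.2 - v) (by fun_prop)
    (fun t => sub_ne_zero.2 (h t.2))
  refine ⟨L (0, 1) - L (0, 0), ?_, fun g c hg H =>
    lift_change_eq g (fun t => L (0, t)) hg (by fun_prop) c (fun t => ?_)⟩
  · rw [Complex.exp_sub]
    have h0 := hL' (0, 0)
    have h1 := hL' (0, 1)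
    simp only at h0 h1
    rw [← h0, ← h1]
    field_simp [Complex.exp_ne_zero]
  · rw [H, hL']

lemma square_change (e f : I → ℂ) (he : Continuous e) (hf : Continuous f)
    (h : ∀ s t, e s ≠ f t) (a b c d : ℂ)
    (ha : IsChange f (e 0) a) (hb : IsChange f (e 1) b)
    (hc : IsChange e (f 0) c) (hd : IsChange e (f 1) d) : a - b = c - d := by
  obtain ⟨L, hL, hL'⟩ := exists_log_lift (fun t => f t.2 - e t.1) (by fun_prop)
    (fun t => sub_ne_zero.2 (h _ _).symm)
  rw [← ha (fun t => L (0, t)) 1 (by fun_prop) (fun t => by rw [hL']; ring),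
    ← hb (fun t => L (1, t)) 1 (by fun_prop) (fun t => by rw [hL']; ring),
    ← hc (fun t => L (t, 0)) (-1) (by fun_prop) (fun t => by rw [hL']; ring),
    ← hd (fun t => L (t, 1)) (-1) (by fun_prop) (fun t => by rw [hL']; ring)]
  ring

/-- The sign of a pair of indices. -/
def pairSign (i i' : Fin 3) : ℤ := if i < i' then 1 else -1

lemma exists_logs (x : Fin 3 → ℂ) (hx : ∀ i i', i ≠ i' → x i ≠ x i') :
    ∃ l : Fin 3 → Fin 3 → ℂ, (∀ i i', i ≠ i' → Complex.exp (l i i') = x i' - x i) ∧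
      ∀ i i', i ≠ i' → l i' i - l i i' = pairSign i i' * (Real.pi * Complex.I) := by
  refine ⟨fun i i' => if i < i' then Complex.log (x i' - x i)
    else Complex.log (x i - x i') + Real.pi * Complex.I, ?_, ?_⟩
  · intro i i' h
    have h1 := sub_ne_zero.2 (hx _ _ h)
    have h2 := sub_ne_zero.2 (hx _ _ h.symm)
    by_cases hlt : i < i'
    · simp only [hlt, if_true]
      rw [Complex.exp_log h2]
    · simp only [hlt, if_false]
      rw [Complex.exp_add, Complex.exp_log h1, Complex.exp_pi_mul_I]
      ring
  · intro i i' h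
    rcases lt_or_gt_of_ne h with hlt | hlt
    · simp [pairSign, hlt, not_lt.2 hlt.le]
    · simp [pairSign, hlt, not_lt.2 hlt.le]

lemma exists_int (a b : ℂ) (h : Complex.exp a = Complex.exp b) :
    ∃ n : ℤ, a = b + n * (2 * Real.pi * Complex.I) :=
  Complex.exp_eq_exp_iff_exists_int.1 h

/-- Strong form of the nonplanarity of `K_{3,3}`. -/
theorem k33 (x y : Fin 3 → ℂ) (γ : ∀ i j, Path (x i) (y j))
    (H : ∀ i i' j j', i ≠ i' → j ≠ j' → ∀ s t, γ i j s ≠ γ i' j' t) : False := by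
  have other : ∀ i : Fin 3, ∃ i', i' ≠ i := by decide
  have hx : ∀ i i' j' t, i ≠ i' → γ i' j' t ≠ x i := by
    intro i i' j' t h
    obtain ⟨j, hj⟩ := other j'
    have := H i i' j j' h hj 0 t
    simpa using this.symm
  have hy : ∀ j i' j' t, j ≠ j' → γ i' j' t ≠ y j := by
    intro j i' j' t h
    obtain ⟨i, hi⟩ := other i'
    have := H i i' j j' hi h 1 t
    simpa using this.symm
  have hxx : ∀ i i', i ≠ i' → x i ≠ x i' := by
    intro i i' h
    have := hx i i' 0 0 h
    simpa using this.symm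
  have hyy : ∀ i i', i ≠ i' → y i ≠ y i' := by
    intro i i' h
    have := hy i 0 i' 1 h
    simpa using this.symm
  have hxy : ∀ i j, y j - x i ≠ 0 := by
    intro i j
    obtain ⟨i', hi⟩ := other i
    have := hx i i' j 1 hi.symm
    exact sub_ne_zero.2 (by simpa using this)
  obtain ⟨lx, hlx, hlx'⟩ := exists_logs x hxx
  obtain ⟨ly, hly, hly'⟩ := exists_logs y hyy
  have hX : ∀ i i' j', ∃ n : ℤ, i ≠ i' → IsChange (γ i' j') (x i)
      (Complex.log (y j' - x i) - lx i i' + n * (2 * Real.pi * Complex.I)) := by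
    intro i i' j'
    by_cases h : i = i'
    · exact ⟨0, fun h' => absurd h h'⟩
    obtain ⟨a, ha, ha'⟩ := exists_change (γ i' j') (γ i' j').continuous (x i)
      (fun t => hx _ _ _ _ h)
    obtain ⟨n, hn⟩ := exists_int a (Complex.log (y j' - x i) - lx i i') (by
      rw [Complex.exp_sub, Complex.exp_log (hxy _ _), eq_div_iff (Complex.exp_ne_zero _),
        hlx _ _ h]
      simpa using ha)
    exact ⟨n, fun _ => hn ▸ ha'⟩
  have hY : ∀ j i' j', ∃ n : ℤ, j ≠ j' → IsChange (γ i' j') (y j)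
      (ly j j' - (Complex.log (y j - x i') + Real.pi * Complex.I)
        + n * (2 * Real.pi * Complex.I)) := by
    intro j i' j'
    by_cases h : j = j'
    · exact ⟨0, fun h' => absurd h h'⟩
    obtain ⟨a, ha, ha'⟩ := exists_change (γ i' j') (γ i' j').continuous (y j)
      (fun t => hy _ _ _ _ h)
    obtain ⟨n, hn⟩ := exists_int a
        (ly j j' - (Complex.log (y j - x i') + Real.pi * Complex.I)) (by
      rw [Complex.exp_sub, eq_div_iff (Complex.exp_ne_zero _), Complex.exp_add,
        Complex.exp_log (hxy _ _), hly _ _ h, Complex.exp_pi_mul_I]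
      simp only [Path.source, Path.target] at ha
      rw [← ha]
      ring)
    exact ⟨n, fun _ => hn ▸ ha'⟩
  choose X hX using hX
  choose Y hY using hY
  have rel : ∀ i i' j j', i ≠ i' → j ≠ j' →
      pairSign i i' + pairSign j j' + 2 * (X i i' j' - Y j i' j' - X i' i j + Y j' i j) = 0 := by
    intro i i' j j' hi hj
    have := square_change (γ i j) (γ i' j') (γ i j).continuous (γ i' j').continuous
      (H i i' j j' hi hj) _ _ _ _ (by simpa using hX i i' j' hi) (by simpa using hY j i' j' hj)
      (by simpa using hX i' i j hi.symm) (by simpa using hY j' i j hj.symm)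
    have e1 := hlx' i i' hi
    have e2 := hly' j j' hj
    have hpi : (Real.pi * Complex.I : ℂ) ≠ 0 := by simp [Real.pi_ne_zero]
    have key : ((pairSign i i' + pairSign j j' +
        2 * (X i i' j' - Y j i' j' - X i' i j + Y j' i j) : ℤ) : ℂ) * (Real.pi * Complex.I) = 0 := by
      push_cast
      linear_combination this - e1 - e2
    have := (mul_eq_zero.1 key).resolve_right hpi
    exact_mod_cast this
  have a1 := rel 0 1 0 1 (by decide) (by decide)
  have a2 := rel 0 1 0 2 (by decide) (by decide)
  have a3 := rel 0 1 1 2 (by decide) (by decide)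
  have a4 := rel 0 1 1 0 (by decide) (by decide)
  have a5 := rel 0 1 2 0 (by decide) (by decide)
  have a6 := rel 0 1 2 1 (by decide) (by decide)
  have b1 := rel 0 2 0 1 (by decide) (by decide)
  have b2 := rel 0 2 0 2 (by decide) (by decide)
  have b3 := rel 0 2 1 2 (by decide) (by decide)
  have b4 := rel 0 2 1 0 (by decide) (by decide)
  have b5 := rel 0 2 2 0 (by decide) (by decide)
  have b6 := rel 0 2 2 1 (by decide) (by decide)
  have c1 := rel 1 2 0 1 (by decide) (by decide)
  have c2 := rel 1 2 0 2 (by decide) (by decide)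
  have c3 := rel 1 2 1 2 (by decide) (by decide)
  have c4 := rel 1 2 1 0 (by decide) (by decide)
  have c5 := rel 1 2 2 0 (by decide) (by decide)
  have c6 := rel 1 2 2 1 (by decide) (by decide)
  simp [pairSign] at a1 a2 a3 a4 a5 a6 b1 b2 b3 b4 b5 b6 c1 c2 c3 c4 c5 c6
  omega

end K33

lemma k33_plane (x y : Fin 3 → Plane) (S : Fin 3 → Fin 3 → Set Plane)
    (hγ : ∀ i j, ∃ p : Path (x i) (y j), ∀ t, p t ∈ S i j)
    (H : ∀ i i' j j', i ≠ i' → j ≠ j' → ∀ p, p ∈ S i j → p ∉ S i' j') : False := by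
  choose γ hγ using hγ
  have hc : Continuous (Complex.equivRealProdCLM.symm : Plane → ℂ) :=
    Complex.equivRealProdCLM.symm.continuous
  refine k33 (fun i => Complex.equivRealProdCLM.symm (x i))
    (fun i => Complex.equivRealProdCLM.symm (y i)) (fun i j => (γ i j).map hc) ?_
  intro i i' j j' hi hj s t h
  have h' : γ i j s = γ i' j' t := Complex.equivRealProdCLM.symm.injective h
  exact H i i' j j' hi hj _ (hγ i j s) (h' ▸ hγ i' j' t)

section Bip
variable {q : ℕ} (D : Drawing (completeBipartiteGraph (Fin 2) (Fin q)))

/-- The image of the curve of the edge between `u_a` and `v_j`. -/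
def bipCurve (a : Fin 2) (j : Fin q) : Set Plane :=
  D.curve s(Sum.inl a, Sum.inr j) '' Set.Icc (0:ℝ) 1

lemma bip_mem (a : Fin 2) (j : Fin q) :
    (s(Sum.inl a, Sum.inr j) : Sym2 (Fin 2 ⊕ Fin q)) ∈
      (completeBipartiteGraph (Fin 2) (Fin q)).edgeSet := by
  simp [completeBipartiteGraph]

lemma bip_ends (a : Fin 2) (j : Fin q) :
    (D.curve s(Sum.inl a, Sum.inr j) 0 = D.pos (Sum.inl a) ∧
      D.curve s(Sum.inl a, Sum.inr j) 1 = D.pos (Sum.inr j)) ∨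
    (D.curve s(Sum.inl a, Sum.inr j) 0 = D.pos (Sum.inr j) ∧
      D.curve s(Sum.inl a, Sum.inr j) 1 = D.pos (Sum.inl a)) :=
  Set.pair_eq_pair_iff.1 (D.curve_ends _ _ (bip_mem a j))

lemma bip_path (a : Fin 2) (j : Fin q) :
    ∃ p : Path (D.pos (Sum.inl a)) (D.pos (Sum.inr j)), ∀ t, p t ∈ bipCurve D a j := by
  have hc := (D.curve_cont _ (bip_mem a j))
  have hc' : Continuous (fun t : unitInterval => D.curve s(Sum.inl a, Sum.inr j) t) :=
    continuousOn_iff_continuous_domRestrict.1 hc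
  rcases bip_ends D a j with ⟨h0, h1⟩ | ⟨h0, h1⟩
  · exact ⟨⟨⟨_, hc'⟩, by simpa using h0, by simpa using h1⟩, fun t => ⟨t, t.2, rfl⟩⟩
  · let p : Path (D.pos (Sum.inr j)) (D.pos (Sum.inl a)) :=
      ⟨⟨_, hc'⟩, by simpa using h0, by simpa using h1⟩
    exact ⟨p.symm, fun t => ⟨unitInterval.symm t, (unitInterval.symm t).2, rfl⟩⟩

lemma bip_cases (a : Fin 2) (j : Fin q) (p : Plane) (hp : p ∈ bipCurve D a j) :
    (∃ s ∈ Set.Ioo (0:ℝ) 1, D.curve s(Sum.inl a, Sum.inr j) s = p) ∨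
      p = D.pos (Sum.inl a) ∨ p = D.pos (Sum.inr j) := by
  obtain ⟨s, hs, rfl⟩ := hp
  rcases eq_or_lt_of_le hs.1 with h | h
  · subst h
    rcases bip_ends D a j with ⟨h0, h1⟩ | ⟨h0, h1⟩ <;> simp [h0]
  rcases eq_or_lt_of_le hs.2 with h' | h'
  · subst h'
    rcases bip_ends D a j with ⟨h0, h1⟩ | ⟨h0, h1⟩ <;> simp [h1]
  exact Or.inl ⟨s, ⟨h, h'⟩, rfl⟩

lemma bip_vertex (a : Fin 2) (j : Fin q) (x : Fin 2 ⊕ Fin q)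
    (hp : D.pos x ∈ bipCurve D a j) : x = Sum.inl a ∨ x = Sum.inr j := by
  rcases bip_cases D a j _ hp with ⟨s, hs, h⟩ | h | h
  · exact absurd h (D.no_vertex_interior _ (bip_mem a j) s hs x)
  · exact Or.inl (D.pos_inj h)
  · exact Or.inr (D.pos_inj h)

lemma bip_disjoint (a b : Fin 2) (i j : Fin q) (hab : a ≠ b) (hij : i ≠ j)
    (h : ¬ D.Crosses s(Sum.inl a, Sum.inr i) s(Sum.inl b, Sum.inr j)) (p : Plane)
    (hp : p ∈ bipCurve D a i) : p ∉ bipCurve D b j := by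
  intro hp'
  rcases bip_cases D a i _ hp with h1 | rfl | rfl
  · rcases bip_cases D b j _ hp' with h2 | rfl | rfl
    · refine h ⟨p, bip_mem _ _, bip_mem _ _, ?_, h1, h2⟩
      simp [hab]
    · have := bip_vertex D a i _ hp
      simp_all
    · have := bip_vertex D a i _ hp
      simp_all
  · have := bip_vertex D b j _ hp'
    simp_all
  · have := bip_vertex D b j _ hp'
    simp_all

lemma bip_closed (a : Fin 2) (j : Fin q) : IsClosed (bipCurve D a j) :=
  (isCompact_Icc.image_of_continuousOn (D.curve_cont _ (bip_mem a j))).isClosed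

lemma bip_count {k : ℕ} (hD : D.IsKPlanar k) (e : Sym2 (Fin 2 ⊕ Fin q)) (a : Fin 2) :
    {j : Fin q | D.Crosses e s(Sum.inl a, Sum.inr j)}.ncard ≤ k := by
  have hinj : Function.Injective
      (fun j : Fin q => (s(Sum.inl a, Sum.inr j) : Sym2 (Fin 2 ⊕ Fin q))) := by
    intro i j h
    simpa using h
  rw [← Set.ncard_image_of_injective _ hinj]
  refine le_trans (Set.ncard_le_ncard (t := Prod.fst '' D.crossingsOf e) ?_
    ((hD e).1.image _)) ((Set.ncard_image_le (hD e).1).trans (hD e).2)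
  rintro _ ⟨j, ⟨p, hp⟩, rfl⟩
  exact ⟨(_, p), hp, rfl⟩

/-- The indices whose path crosses the path of `i`. -/
noncomputable def bipBad (i : Fin q) : Finset (Fin q) :=
  (Set.toFinite ({j : Fin q | D.Crosses s(Sum.inl 0, Sum.inr i) s(Sum.inl 1, Sum.inr j)} ∪
    {j : Fin q | D.Crosses s(Sum.inl 1, Sum.inr i) s(Sum.inl 0, Sum.inr j)})).toFinset

lemma bipBad_card {k : ℕ} (hD : D.IsKPlanar k) (i : Fin q) : (bipBad D i).card ≤ 2 * k := by
  rw [bipBad, ← Set.ncard_eq_toFinset_card]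
  have h1 := bip_count D hD s(Sum.inl 0, Sum.inr i) 1
  have h2 := bip_count D hD s(Sum.inl 1, Sum.inr i) 0
  have := Set.ncard_union_le
    {j : Fin q | D.Crosses s(Sum.inl 0, Sum.inr i) s(Sum.inl 1, Sum.inr j)}
    {j : Fin q | D.Crosses s(Sum.inl 1, Sum.inr i) s(Sum.inl 0, Sum.inr j)}
  omega

lemma crosses_symm {e f : Sym2 (Fin 2 ⊕ Fin q)} (h : D.Crosses e f) : D.Crosses f e := by
  obtain ⟨p, h1, h2, h3, h4, h5⟩ := h
  exact ⟨p, h2, h1, h3.symm, h5, h4⟩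

lemma not_bad {i j : Fin q} (h : j ∉ bipBad D i) :
    ¬ D.Crosses s(Sum.inl 0, Sum.inr i) s(Sum.inl 1, Sum.inr j) ∧
    ¬ D.Crosses s(Sum.inl 0, Sum.inr j) s(Sum.inl 1, Sum.inr i) := by
  simp only [bipBad, Set.Finite.mem_toFinset, Set.mem_union, Set.mem_ofPred_eq, not_or] at h
  exact ⟨h.1, fun h' => h.2 (crosses_symm D h')⟩

lemma exists_not_mem_of_card (S : Finset (Fin q)) (h : S.card < q) : ∃ j, j ∉ S := by
  by_contra! hc
  have : S = Finset.univ := Finset.eq_univ_iff_forall.2 hc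
  rw [this, Finset.card_univ, Fintype.card_fin] at h
  exact lt_irrefl _ h

lemma exists_triple {k : ℕ} (hq : 4 * k + 9 ≤ q) (hD : D.IsKPlanar k) :
    ∃ (v : Fin 3 → Fin q) (w : Fin q), Function.Injective v ∧ (∀ i, v i ≠ w) ∧
      ∀ i j, i ≠ j → ¬ D.Crosses s(Sum.inl 0, Sum.inr (v i)) s(Sum.inl 1, Sum.inr (v j)) := by
  classical
  obtain ⟨a, -⟩ := exists_not_mem_of_card (q := q) ∅ (by simp; omega)
  obtain ⟨b, hb⟩ := exists_not_mem_of_card ({a} ∪ bipBad D a) (by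
    have := Finset.card_union_le {a} (bipBad D a)
    have := bipBad_card D hD a
    simp at *
    omega)
  obtain ⟨c, hc⟩ := exists_not_mem_of_card ({a, b} ∪ (bipBad D a ∪ bipBad D b)) (by
    have := Finset.card_union_le {a, b} (bipBad D a ∪ bipBad D b)
    have := Finset.card_union_le (bipBad D a) (bipBad D b)
    have := bipBad_card D hD a
    have := bipBad_card D hD b
    have := Finset.card_le_two (a := a) (b := b)
    omega)
  obtain ⟨w, hw⟩ := exists_not_mem_of_card {a, b, c} (by
    have := Finset.card_le_three (a := a) (b := b) (c := c)
    omega)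
  simp only [Finset.mem_union, Finset.mem_singleton, Finset.mem_insert, not_or] at hb hc hw
  have n1 := not_bad D hb.2
  have n2 := not_bad D hc.2.1
  have n3 := not_bad D hc.2.2
  refine ⟨![a, b, c], w, ?_, ?_, ?_⟩
  · intro i j h
    fin_cases i <;> fin_cases j <;> simp_all
  · intro i
    fin_cases i <;> simp <;> tauto
  · intro i j hij
    fin_cases i <;> fin_cases j <;> simp_all

end Bip

/-- For every `k ≥ 0` and `q ≥ 4k + 9`, the complete bipartite graph
`K_{2,q}` has the separating cycle property for `k`-planar drawings: in every drawing in
which each edge is crossed at most `k` times there are a 4-cycle `C` and two vertices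
`x ≠ y` not on `C` whose points lie in different connected components of the complement
of the union of the curves of the four edges of `C`. -/
theorem completeBipartite_separating_cycle_property (k q : ℕ) (hq : 4 * k + 9 ≤ q)
    (D : Drawing (completeBipartiteGraph (Fin 2) (Fin q))) (hD : D.IsKPlanar k) :
    ∃ c : Fin 4 → (Fin 2) ⊕ (Fin q),
      Function.Injective c ∧
      (∀ i : Fin 4, (completeBipartiteGraph (Fin 2) (Fin q)).Adj (c i) (c (i + 1))) ∧
      ∃ x y : (Fin 2) ⊕ (Fin q), x ≠ y ∧ (∀ i : Fin 4, x ≠ c i) ∧ (∀ i : Fin 4, y ≠ c i) ∧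
        D.pos x ∈ (⋃ i : Fin 4, D.curve s(c i, c (i + 1)) '' Set.Icc (0:ℝ) 1)ᶜ ∧
        D.pos y ∈ (⋃ i : Fin 4, D.curve s(c i, c (i + 1)) '' Set.Icc (0:ℝ) 1)ᶜ ∧
        D.pos y ∉ connectedComponentIn
          (⋃ i : Fin 4, D.curve s(c i, c (i + 1)) '' Set.Icc (0:ℝ) 1)ᶜ (D.pos x) := by
  classical
  obtain ⟨v, w, hv, hw, hvc⟩ := exists_triple D hq hD
  by_contra hcon
  have hpath : ∀ l : Fin 3, ∃ p : Path (D.pos (Sum.inr w)) (D.pos (Sum.inr (v l))),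
      ∀ t, p t ∈ {z : Plane | ∀ a, ∀ i, i ≠ l → z ∉ bipCurve D a (v i)} := by
    intro l
    obtain ⟨i, j, hij, hil, hjl, hall⟩ : ∃ i j : Fin 3, i ≠ j ∧ i ≠ l ∧ j ≠ l ∧
        ∀ m, m ≠ l → m = i ∨ m = j := by
      revert l
      decide
    set c : Fin 4 → Fin 2 ⊕ Fin q :=
      ![Sum.inl 0, Sum.inr (v i), Sum.inl 1, Sum.inr (v j)] with hcdef
    have hU : (⋃ m : Fin 4, D.curve s(c m, c (m + 1)) '' Set.Icc (0:ℝ) 1) =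
        bipCurve D 0 (v i) ∪ bipCurve D 1 (v i) ∪ (bipCurve D 1 (v j) ∪ bipCurve D 0 (v j)) := by
      have e1 : (s(Sum.inr (v i), Sum.inl 1) : Sym2 (Fin 2 ⊕ Fin q)) =
        s(Sum.inl 1, Sum.inr (v i)) := Sym2.eq_swap
      have e2 : (s(Sum.inr (v j), Sum.inl 0) : Sym2 (Fin 2 ⊕ Fin q)) =
        s(Sum.inl 0, Sum.inr (v j)) := Sym2.eq_swap
      have f0 : s(c 0, c (0 + 1)) = s(Sum.inl 0, Sum.inr (v i)) := rfl
      have f1 : s(c 1, c (1 + 1)) = s(Sum.inl 1, Sum.inr (v i)) := e1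
      have f2 : s(c 2, c (2 + 1)) = s(Sum.inl 1, Sum.inr (v j)) := rfl
      have f3 : s(c 3, c (3 + 1)) = s(Sum.inl 0, Sum.inr (v j)) := e2
      ext z
      simp only [Set.mem_iUnion, Set.mem_union, bipCurve]
      rw [← f0, ← f1, ← f2, ← f3]
      constructor
      · rintro ⟨m, hm⟩
        fin_cases m
        · exact Or.inl (Or.inl hm)
        · exact Or.inl (Or.inr hm)
        · exact Or.inr (Or.inl hm)
        · exact Or.inr (Or.inr hm)
      · rintro ((hm | hm) | (hm | hm))
        · exact ⟨0, hm⟩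
        · exact ⟨1, hm⟩
        · exact ⟨2, hm⟩
        · exact ⟨3, hm⟩
    set U := (⋃ m : Fin 4, D.curve s(c m, c (m + 1)) '' Set.Icc (0:ℝ) 1) with hUdef
    have hUc : IsOpen Uᶜ := by
      rw [hU]
      exact (((bip_closed D _ _).union (bip_closed D _ _)).union
        ((bip_closed D _ _).union (bip_closed D _ _))).isOpen_compl
    have hvert : ∀ r : Fin q, r ≠ v i → r ≠ v j → D.pos (Sum.inr r) ∈ Uᶜ := by
      intro r h1 h2 hr
      rw [hU] at hr
      rcases hr with (hr | hr) | (hr | hr) <;>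
      · rcases bip_vertex D _ _ _ hr with h | h
        · exact absurd h (by simp)
        · have h3 := Sum.inr.inj h
          first | exact h1 h3 | exact h2 h3
    have hvij : v i ≠ v j := fun h => hij (hv h)
    have hwU := hvert w (hw i).symm (hw j).symm
    have hlU := hvert (v l) (fun h => hil (hv h).symm) (fun h => hjl (hv h).symm)
    have hmem : D.pos (Sum.inr (v l)) ∈ connectedComponentIn Uᶜ (D.pos (Sum.inr w)) := by
      by_contra hnot
      refine hcon ⟨c, ?_, ?_, Sum.inr w, Sum.inr (v l), ?_, ?_, ?_, hwU, hlU, hnot⟩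
      · intro m n
        fin_cases m <;> fin_cases n <;> simp [hcdef, hvij, hvij.symm]
      · intro m
        fin_cases m <;> simp [hcdef, completeBipartiteGraph]
      · simpa using (hw l).symm
      · intro m
        fin_cases m <;> simp [hcdef, (hw i).symm, (hw j).symm]
      · intro m
        fin_cases m <;> simp [hcdef, hv.eq_iff, hil.symm, hjl.symm]
    have hconn : IsPathConnected (connectedComponentIn Uᶜ (D.pos (Sum.inr w))) :=
      hUc.connectedComponentIn.isConnected_iff_isPathConnected.1
        (isConnected_connectedComponentIn_iff.2 hwU)
    obtain ⟨p, hp⟩ := hconn.joinedIn _ (mem_connectedComponentIn hwU) _ hmem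
    refine ⟨p, fun t a m hm hz => ?_⟩
    have h1 := connectedComponentIn_subset _ _ (hp t)
    rw [hU] at h1
    apply h1
    simp only [Set.mem_union]
    rcases hall m hm with rfl | rfl <;> fin_cases a
    · exact Or.inl (Or.inl hz)
    · exact Or.inl (Or.inr hz)
    · exact Or.inr (Or.inr hz)
    · exact Or.inr (Or.inl hz)
  refine k33_plane ![D.pos (Sum.inl 0), D.pos (Sum.inl 1), D.pos (Sum.inr w)]
    (fun j => D.pos (Sum.inr (v j)))
    (fun i j => ![bipCurve D 0 (v j), bipCurve D 1 (v j),
      {z : Plane | ∀ a, ∀ i, i ≠ j → z ∉ bipCurve D a (v i)}] i) ?_ ?_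
  · intro i j
    fin_cases i
    · exact bip_path D 0 (v j)
    · exact bip_path D 1 (v j)
    · exact hpath j
  · have main : ∀ j j', j ≠ j' → ∀ p, p ∈ bipCurve D 0 (v j) → p ∉ bipCurve D 1 (v j') :=
      fun j j' hj => bip_disjoint D 0 1 _ _ (by decide) (fun h => hj (hv h)) (hvc j j' hj)
    intro i i' j j' hi hj p hp hp'
    fin_cases i <;> fin_cases i'
    · exact hi rfl
    · exact main j j' hj p hp hp'
    · exact hp' 0 j hj hp
    · exact main j' j hj.symm p hp' hp
    · exact hi rfl
    · exact hp' 1 j hj hp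
    · exact hp 0 j' hj.symm hp'
    · exact hp 1 j' hj.symm hp'
    · exact hi rfl
end

section
/- For every k ≥ 0, the class of k-planar graphs is not closed under path-addition: there exist a k-planar finite simple graph G, distinct vertices u, v of G, and a path P of length at least |V(G)|−1 from u to v whose internal vertices are new, such that for every supplementary edge set F the graph G ⊕ P ⊕ F is not k-planar; indeed some finite sequence of path-additions between two fixed vertices of K_{2,q} (for q ≥ 4k+9) produces a graph that is not k-planar. -/
/-! ### Topological part: the complete graph on five vertices has no planar drawing -/

/-- Continuous logarithms exist on real normed spaces. -/
lemma exists_cont_log {E : Type*} [NormedAddCommGroup E] [NormedSpace ℝ E] (g : E → ℂ)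
    (hg : Continuous g) (h0 : ∀ x, g x ≠ 0) :
    ∃ f : E → ℂ, Continuous f ∧ ∀ x, Complex.exp (f x) = g x := by
  obtain ⟨F, ⟨-, hF⟩, -⟩ := Complex.isCoveringMapOn_exp.existsUnique_continuousMap_lifts
    (⟨g, hg⟩ : C(E, ℂ)) (a₀ := 0) (Complex.exp_log (h0 0)) (fun x => h0 x)
  exact ⟨F, F.continuous, fun x => congrFun hF x⟩

/-- Two continuous logarithms of the same function have equal increments. -/
lemma log_incr_unique {E : Type*} [TopologicalSpace E] [PreconnectedSpace E] (f g : E → ℂ)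
    (hf : Continuous f) (hg : Continuous g)
    (h : ∀ x, Complex.exp (f x) = Complex.exp (g x)) (x y : E) :
    f x - f y = g x - g y := by
  have key := Complex.isCoveringMap_exp.eq_of_comp_eq (A := E) (g₁ := f)
    (g₂ := fun z => g z + (f y - g y)) hf (by fun_prop) (by
      funext z
      apply Subtype.ext
      simp only [Function.comp_apply]
      rw [Complex.exp_add, Complex.exp_sub, h z, h y, div_self (Complex.exp_ne_zero _), mul_one])
      y (by ring)
  have := congrFun key x
  rw [this]; ring

open Classical in
/-- The increment over `[0,1]` of a continuous logarithm of `h`. -/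
noncomputable def logIncr (h : ℝ → ℂ) : ℂ :=
  if H : ∃ f : ℝ → ℂ, Continuous f ∧ ∀ x, Complex.exp (f x) = h x then
    H.choose 1 - H.choose 0 else 0

lemma logIncr_eq (h f : ℝ → ℂ) (hf : Continuous f) (he : ∀ x, Complex.exp (f x) = h x) :
    logIncr h = f 1 - f 0 := by
  have H : ∃ f : ℝ → ℂ, Continuous f ∧ ∀ x, Complex.exp (f x) = h x := ⟨f, hf, he⟩
  rw [logIncr, dif_pos H]
  exact log_incr_unique _ _ H.choose_spec.1 hf
    (fun x => (H.choose_spec.2 x).trans (he x).symm) _ _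

lemma logIncr_int (h : ℝ → ℂ) (hc : Continuous h) (h0 : ∀ x, h x ≠ 0) (a b : ℂ)
    (ha : Complex.exp a = h 0) (hb : Complex.exp b = h 1) :
    ∃ n : ℤ, logIncr h = b - a + n * (2 * Real.pi * Complex.I) := by
  obtain ⟨f, hf, he⟩ := exists_cont_log h hc h0
  obtain ⟨m, hm⟩ := Complex.exp_eq_exp_iff_exists_int.1 ((he 0).trans ha.symm)
  obtain ⟨n, hn⟩ := Complex.exp_eq_exp_iff_exists_int.1 ((he 1).trans hb.symm)
  refine ⟨n - m, ?_⟩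
  rw [logIncr_eq h f hf he, hm, hn]
  push_cast; ring

lemma logIncr_square (a b : ℝ → ℂ) (ha : Continuous a) (hb : Continuous b)
    (h : ∀ s t, a s ≠ b t) :
    logIncr (fun s => a s - b 0) + logIncr (fun t => b t - a 1) =
      logIncr (fun s => a s - b 1) + logIncr (fun t => b t - a 0) := by
  obtain ⟨f, hf, he⟩ := exists_cont_log (fun x : ℝ × ℝ => a x.1 - b x.2) (by fun_prop)
    (fun x => sub_ne_zero.2 (h _ _))
  have hpi : ∀ x, Complex.exp (f x + Real.pi * Complex.I) = b x.2 - a x.1 := by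
    intro x
    rw [Complex.exp_add, he, Complex.exp_pi_mul_I]; ring
  rw [logIncr_eq _ (fun s => f (s, 0)) (by fun_prop) (fun s => he (s, 0)),
    logIncr_eq _ (fun s => f (s, 1)) (by fun_prop) (fun s => he (s, 1)),
    logIncr_eq _ (fun t => f (1, t) + Real.pi * Complex.I) (by fun_prop) (fun t => hpi (1, t)),
    logIncr_eq _ (fun t => f (0, t) + Real.pi * Complex.I) (by fun_prop) (fun t => hpi (0, t))]
  ring

/-- There are no ten curves joining five points pairwise such that curves without common
endpoints are disjoint. -/
theorem no_planar_K5 (p : Fin 5 → ℂ) (γ : Fin 5 → Fin 5 → ℝ → ℂ)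
    (hc : ∀ i j, i < j → Continuous (γ i j))
    (h0 : ∀ i j, i < j → γ i j 0 = p i) (h1 : ∀ i j, i < j → γ i j 1 = p j)
    (hd : ∀ i j k l, i < j → k < l → i ≠ k → i ≠ l → j ≠ k → j ≠ l →
      ∀ s t, γ i j s ≠ γ k l t) : False := by
  have hpγ : ∀ i j v, i < j → v ≠ i → v ≠ j → ∀ s, γ i j s ≠ p v := by
    intro i j v hij hi hj s
    obtain ⟨w, hwv, hwi, hwj⟩ : ∃ w : Fin 5, w ≠ v ∧ w ≠ i ∧ w ≠ j := by
      revert i j v; decide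
    rcases lt_or_gt_of_ne hwv with hlt | hlt
    · rw [← h1 w v hlt]
      exact hd i j w v hij hlt hwi.symm hi.symm hwj.symm hj.symm s 1
    · rw [← h0 v w hlt]
      exact hd i j v w hij hlt hi.symm hwi.symm hj.symm hwj.symm s 0
  have hp : ∀ i j, i ≠ j → p i ≠ p j := by
    intro i j hij
    obtain ⟨w, hwi, hwj⟩ : ∃ w : Fin 5, w ≠ i ∧ w ≠ j := by
      revert i j; decide
    rcases lt_or_gt_of_ne hwi with hlt | hlt
    · rw [← h1 w i hlt]
      exact hpγ w i j hlt hwj.symm hij.symm 1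
    · rw [← h0 i w hlt]
      exact hpγ i w j hlt hij.symm hwj.symm 0
  obtain ⟨L, hL, hLs⟩ : ∃ L : Fin 5 → Fin 5 → ℂ,
      (∀ i j, i ≠ j → Complex.exp (L i j) = p i - p j) ∧
      (∀ i j, i < j → L j i = L i j + Real.pi * Complex.I) := by
    refine ⟨fun i j => if i < j then Complex.log (p i - p j) else
      Complex.log (p j - p i) + Real.pi * Complex.I, ?_, ?_⟩
    · intro i j hij
      have e1 := sub_ne_zero.2 (hp i j hij)
      have e2 := sub_ne_zero.2 (hp j i hij.symm)
      by_cases h : i < j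
      · simp only [h, if_true]
        exact Complex.exp_log e1
      · simp only [h, if_false]
        rw [Complex.exp_add, Complex.exp_log e2, Complex.exp_pi_mul_I]; ring
    · intro i j hij
      simp only [hij, hij.not_gt, if_true, if_false]
  have hint : ∀ i j v, ∃ n : ℤ, i < j → v ≠ i → v ≠ j →
      logIncr (fun s => γ i j s - p v) = L j v - L i v + n * (2 * Real.pi * Complex.I) := by
    intro i j v
    by_cases h : i < j ∧ v ≠ i ∧ v ≠ j
    · obtain ⟨hij, hi, hj⟩ := h
      have := hc i j hij
      obtain ⟨n, hn⟩ := logIncr_int (fun s => γ i j s - p v) (by fun_prop)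
        (fun s => sub_ne_zero.2 (hpγ i j v hij hi hj s)) (L i v) (L j v)
        (by rw [hL _ _ hi.symm, h0 i j hij]) (by rw [hL _ _ hj.symm, h1 i j hij])
      exact ⟨n, fun _ _ _ => hn⟩
    · exact ⟨0, fun a b c => absurd ⟨a, b, c⟩ h⟩
  choose n hn using hint
  have hsq : ∀ i j k l, i < j → k < l → i ≠ k → i ≠ l → j ≠ k → j ≠ l →
      (L j k - L i k + n i j k * (2 * Real.pi * Complex.I)) +
      (L l j - L k j + n k l j * (2 * Real.pi * Complex.I)) =
      (L j l - L i l + n i j l * (2 * Real.pi * Complex.I)) +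
      (L l i - L k i + n k l i * (2 * Real.pi * Complex.I)) := by
    intro i j k l hij hkl hik hil hjk hjl
    rw [← hn i j k hij hik.symm hjk.symm, ← hn i j l hij hil.symm hjl.symm,
      ← hn k l i hkl hik hil, ← hn k l j hkl hjk hjl]
    have := logIncr_square (γ i j) (γ k l) (hc i j hij) (hc k l hkl)
      (hd i j k l hij hkl hik hil hjk hjl)
    rwa [h0 i j hij, h0 k l hkl, h1 i j hij, h1 k l hkl] at this
  have hpi : (2 * Real.pi * Complex.I : ℂ) ≠ 0 := Complex.two_pi_I_ne_zero
  have key : ∀ a b c d, a < b → b < c → c < d →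
      (n a b c + n c d b = n a b d + n c d a) ∧
      (n a d b + n b c d = n a d c + n b c a) ∧
      (∃ e : ℤ, n a c b + n b d c + (2 * e + 1) = n a c d + n b d a) := by
    intro a b c d hab hbc hcd
    have hac := hab.trans hbc
    have hbd := hbc.trans hcd
    have had := hac.trans hcd
    have s1 := hsq a b c d hab hcd hac.ne had.ne hbc.ne hbd.ne
    have s2 := hsq a d b c had hbc hab.ne hac.ne hbd.ne' hcd.ne'
    have s3 := hsq a c b d hac hbd hab.ne had.ne hbc.ne' hcd.ne
    rw [hLs a c hac, hLs a d had, hLs b c hbc, hLs b d hbd] at s1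
    rw [hLs a b hab, hLs a c hac, hLs b d hbd, hLs c d hcd] at s2
    rw [hLs a b hab, hLs b c hbc, hLs a d had, hLs c d hcd] at s3
    refine ⟨?_, ?_, ?_⟩
    · have : ((n a b c + n c d b : ℤ) : ℂ) = ((n a b d + n c d a : ℤ) : ℂ) := by
        apply mul_right_cancel₀ hpi
        push_cast
        linear_combination s1
      exact_mod_cast this
    · have : ((n a d b + n b c d : ℤ) : ℂ) = ((n a d c + n b c a : ℤ) : ℂ) := by
        apply mul_right_cancel₀ hpi
        push_cast
        linear_combination s2
      exact_mod_cast this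
    · refine ⟨0, ?_⟩
      have : ((n a c b + n b d c + (2 * 0 + 1) : ℤ) : ℂ) = ((n a c d + n b d a : ℤ) : ℂ) := by
        apply mul_right_cancel₀ hpi
        push_cast
        linear_combination s3
      exact_mod_cast this
  obtain ⟨u1, u2, x1, u3⟩ := key 0 1 2 3 (by decide) (by decide) (by decide)
  obtain ⟨v1, v2, x2, v3⟩ := key 0 1 2 4 (by decide) (by decide) (by decide)
  obtain ⟨w1, w2, x3, w3⟩ := key 0 1 3 4 (by decide) (by decide) (by decide)
  obtain ⟨y1, y2, x4, y3⟩ := key 0 2 3 4 (by decide) (by decide) (by decide)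
  obtain ⟨z1, z2, x5, z3⟩ := key 1 2 3 4 (by decide) (by decide) (by decide)
  omega

/-! ### Combinatorial part -/

/-- `x` and `y` are connected by a walk using edges of `T`. -/
def TConn {V : Type*} (T : Set (Sym2 V)) (x y : V) : Prop :=
  Relation.ReflTransGen (fun a b => s(a, b) ∈ T) x y

lemma TConn.map {V W : Type*} {T : Set (Sym2 V)} {x y : V} (f : V → W) (h : TConn T x y) :
    TConn (Sym2.map f '' T) (f x) (f y) :=
  Relation.ReflTransGen.lift f (fun a b hab => ⟨s(a, b), hab, by simp⟩) _ _ h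

/-- Restriction of a drawing along an injective homomorphism. -/
def Drawing.restrict {V W : Type*} {G : SimpleGraph V} {H : SimpleGraph W} (D : Drawing H)
    (φ : V → W) (hφ : Function.Injective φ) (he : ∀ e ∈ G.edgeSet, Sym2.map φ e ∈ H.edgeSet) :
    Drawing G where
  pos := fun x => D.pos (φ x)
  curve := fun e => D.curve (Sym2.map φ e)
  pos_inj := D.pos_inj.comp hφ
  curve_cont := fun e h => D.curve_cont _ (he e h)
  curve_inj := fun e h => D.curve_inj _ (he e h)
  curve_ends := fun x y h => D.curve_ends (φ x) (φ y) (he s(x, y) h)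
  no_vertex_interior := fun e h s hs x => D.no_vertex_interior _ (he e h) s hs (φ x)
  finite_meets := fun e h f h' hne =>
    D.finite_meets _ (he e h) _ (he f h') (fun h => hne (Sym2.map.injective hφ h))
  shared_endpoint := fun e h f h' hne x hx hx' =>
    D.shared_endpoint _ (he e h) _ (he f h') (fun h => hne (Sym2.map.injective hφ h)) (φ x)
      (Sym2.mem_map.2 ⟨x, hx, rfl⟩) (Sym2.mem_map.2 ⟨x, hx', rfl⟩)

lemma Drawing.restrict_isCrossingPt {V W : Type*} {G : SimpleGraph V} {H : SimpleGraph W}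
    (D : Drawing H) (φ : V → W) (hφ : Function.Injective φ)
    (he : ∀ e ∈ G.edgeSet, Sym2.map φ e ∈ H.edgeSet) (e f : Sym2 V) (p : Plane) :
    (D.restrict φ hφ he).IsCrossingPt e f p ↔
      e ∈ G.edgeSet ∧ f ∈ G.edgeSet ∧ D.IsCrossingPt (Sym2.map φ e) (Sym2.map φ f) p := by
  constructor
  · rintro ⟨h1, h2, h3, h4, h5⟩
    exact ⟨h1, h2, he e h1, he f h2, fun h => h3 (Sym2.map.injective hφ h), h4, h5⟩
  · rintro ⟨h1, h2, h3, h4, h5, h6, h7⟩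
    exact ⟨h1, h2, fun h => h5 (by rw [h]), h6, h7⟩

lemma Drawing.restrict_isKPlanar {V W : Type*} {G : SimpleGraph V} {H : SimpleGraph W}
    (D : Drawing H) (φ : V → W) (hφ : Function.Injective φ)
    (he : ∀ e ∈ G.edgeSet, Sym2.map φ e ∈ H.edgeSet) (k : ℕ) (hD : D.IsKPlanar k) :
    (D.restrict φ hφ he).IsKPlanar k := by
  intro e
  have hinj : Function.Injective (Prod.map (Sym2.map φ) (id : Plane → Plane)) :=
    (Sym2.map.injective hφ).prodMap Function.injective_id
  have hsub : Prod.map (Sym2.map φ) (id : Plane → Plane) '' ((D.restrict φ hφ he).crossingsOf e) ⊆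
      D.crossingsOf (Sym2.map φ e) := by
    rintro _ ⟨⟨f, p⟩, h, rfl⟩
    exact ((D.restrict_isCrossingPt φ hφ he e f p).1 h).2.2
  obtain ⟨hfin, hcard⟩ := hD (Sym2.map φ e)
  refine ⟨(hfin.subset hsub).of_finite_image hinj.injOn, ?_⟩
  rw [← Set.ncard_image_of_injective _ hinj]
  exact (Set.ncard_le_ncard hsub hfin).trans hcard

/-- The closure property to be refuted. -/
def PAClosed (k : ℕ) : Prop :=
  ∀ (V : Type) [Fintype V] (G : SimpleGraph V), IsKPlanarGraph G k → ∀ u v : V, u ≠ v →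
    ∀ t : ℕ, Fintype.card V - 1 ≤ t + 1 →
      ∃ F : Set (Sym2 (V ⊕ Fin t)), IsKPlanarGraph (pathAdd G u v t F) k

lemma chainVertex_mem {α : Type*} (a b : α) {t : ℕ} (w : Fin t → α) (i : Fin (t + 2)) :
    chainVertex a b w i = a ∨ chainVertex a b w i = b ∨ chainVertex a b w i ∈ Set.range w := by
  unfold chainVertex
  split_ifs
  · exact Or.inl rfl
  · exact Or.inr (Or.inl rfl)
  · exact Or.inr (Or.inr ⟨_, rfl⟩)

lemma chainEdges_conn {α : Type*} (a b : α) {t : ℕ} (w : Fin t → α) :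
    TConn (chainEdges a b w) a b := by
  have : ∀ i : ℕ, ∀ h : i < t + 2, TConn (chainEdges a b w) a (chainVertex a b w ⟨i, h⟩) := by
    intro i
    induction i with
    | zero => 
      intro h
      have h0 : chainVertex a b w ⟨0, h⟩ = a := by simp [chainVertex]
      rw [h0]
      exact Relation.ReflTransGen.refl
    | succ i ih =>
      intro h
      exact (ih (by omega)).tail ⟨⟨i, by omega⟩, rfl⟩
  simpa [chainVertex] using this (t + 1) (by omega)

lemma chainEdges_mem {α : Type*} (a b : α) {t : ℕ} (w : Fin t → α) (e : Sym2 α)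
    (he : e ∈ chainEdges a b w) (x : α) (hx : x ∈ e) : x = a ∨ x = b ∨ x ∈ Set.range w := by
  obtain ⟨i, rfl⟩ := he
  rcases Sym2.mem_iff.1 hx with rfl | rfl <;> exact chainVertex_mem _ _ _ _

lemma chainEdges_inner {α : Type*} (a b : α) {t : ℕ} (ht : 1 ≤ t) (w : Fin t → α) (e : Sym2 α)
    (he : e ∈ chainEdges a b w) : ∃ x ∈ e, x ∈ Set.range w := by
  obtain ⟨⟨i, hi⟩, rfl⟩ := he
  by_cases h : i = 0
  · refine ⟨_, Sym2.mem_mk_right _ _, ?_⟩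
    subst h
    have : ¬ (t = 0) := by omega
    simp [chainVertex, eq_comm, this]
  · refine ⟨_, Sym2.mem_mk_left _ _, ?_⟩
    have : ¬ (i = t + 1) := by omega
    simp [chainVertex, h, this]

lemma chainEdges_not_diag {α : Type*} (a b : α) (hab : a ≠ b) {t : ℕ} (w : Fin t → α)
    (hw : Function.Injective w) (ha : a ∉ Set.range w) (hb : b ∉ Set.range w) (e : Sym2 α)
    (he : e ∈ chainEdges a b w) : ¬ e.IsDiag := by
  obtain ⟨⟨i, hi⟩, rfl⟩ := he
  rw [Sym2.mk_isDiag_iff]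
  intro h
  simp only [chainVertex, Fin.val_castSucc, Fin.val_succ] at h
  split_ifs at h with h1 h2 h3 h4 h5 h6
  all_goals first
    | omega
    | exact hab h
    | exact ha ⟨_, h.symm⟩
    | exact hb ⟨_, h⟩
    | (have := hw h; simp only [Fin.mk.injEq] at this; omega)

/-- Adding `M` paths between `u` and `v`. -/
lemma exists_family (k : ℕ) (hcl : PAClosed k) (V : Type) [Fintype V] (G : SimpleGraph V)
    (hG : IsKPlanarGraph G k) (u v : V) (huv : u ≠ v) (M : ℕ) :
    ∃ (V' : Type) (_ : Fintype V') (G' : SimpleGraph V') (φ : V → V'),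
      IsKPlanarGraph G' k ∧ Function.Injective φ ∧
      (∀ e ∈ G.edgeSet, Sym2.map φ e ∈ G'.edgeSet) ∧
      ∃ T : ℕ → Set (Sym2 V'), ∀ i < M, T i ⊆ G'.edgeSet ∧ TConn (T i) (φ u) (φ v) ∧
        (∀ e ∈ T i, ∀ x ∈ e, x = φ u ∨ x = φ v ∨ x ∉ Set.range φ) ∧
        (∀ e ∈ T i, ∃ x ∈ e, x ∉ Set.range φ) ∧
        (∀ j < M, i ≠ j → ∀ e ∈ T i, e ∉ T j) := by
  induction M with
  | zero =>
    exact ⟨V, inferInstance, G, id, hG, Function.injective_id, by simp, fun _ => ∅, by simp⟩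
  | succ M ih =>
    obtain ⟨V', iV', G', φ, hG', hφ, hhom, T, hT⟩ := ih
    set t := Fintype.card V' + 1 with ht
    have huv' : φ u ≠ φ v := fun h => huv (hφ h)
    obtain ⟨F, hF⟩ := hcl V' G' hG' (φ u) (φ v) huv' t (by omega)
    set C : Set (Sym2 (V' ⊕ Fin t)) :=
      chainEdges (Sum.inl (φ u)) (Sum.inl (φ v)) (fun i => Sum.inr i) with hC
    have hold : ∀ e ∈ G'.edgeSet, Sym2.map Sum.inl e ∈ (pathAdd G' (φ u) (φ v) t F).edgeSet := by
      intro e he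
      rw [pathAdd, SimpleGraph.edgeSet_fromEdgeSet]
      refine ⟨Or.inl (Or.inl ⟨e, he, rfl⟩), ?_⟩
      have h1 := G'.not_isDiag_of_mem_edgeSet he
      change ¬ (Sym2.map Sum.inl e).IsDiag
      rwa [Sym2.isDiag_map Sum.inl_injective]
    have hnewC : C ⊆ (pathAdd G' (φ u) (φ v) t F).edgeSet := by
      intro e he
      rw [pathAdd, SimpleGraph.edgeSet_fromEdgeSet]
      refine ⟨Or.inl (Or.inr he), ?_⟩
      exact chainEdges_not_diag _ _ (fun h => huv' (Sum.inl_injective h)) _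
        Sum.inr_injective (by simp) (by simp) e he
    have hdisj : ∀ e : Sym2 V', Sym2.map (Sum.inl : V' → V' ⊕ Fin t) e ∉ C := by
      intro e he
      obtain ⟨x, hx, y, rfl⟩ := chainEdges_inner _ _ (by omega) _ _ he
      obtain ⟨z, -, hz⟩ := Sym2.mem_map.1 hx
      cases hz
    refine ⟨V' ⊕ Fin t, inferInstance, pathAdd G' (φ u) (φ v) t F, fun x => Sum.inl (φ x), hF,
      Sum.inl_injective.comp hφ, ?_, fun i => if i = M then C else Sym2.map Sum.inl '' T i, ?_⟩
    · intro e he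
      have := hold _ (hhom e he)
      rwa [Sym2.map_map] at this
    · intro i hi
      by_cases hiM : i = M
      · simp only [hiM, if_true]
        refine ⟨hnewC, chainEdges_conn _ _ _, ?_, ?_, ?_⟩
        · intro e he x hx
          rcases chainEdges_mem _ _ _ e he x hx with h | h | ⟨y, rfl⟩
          · exact Or.inl h
          · exact Or.inr (Or.inl h)
          · exact Or.inr (Or.inr (by simp))
        · intro e he
          obtain ⟨x, hx, y, rfl⟩ := chainEdges_inner _ _ (by omega) _ _ he
          exact ⟨_, hx, by simp⟩
        · intro j hj hij e he he'
          rw [if_neg hij.symm] at he'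
          obtain ⟨e', -, rfl⟩ := he'
          exact hdisj _ he
      · simp only [hiM, if_false]
        obtain ⟨h1, h2, h3, h4, h5⟩ := hT i (by omega)
        refine ⟨?_, h2.map _, ?_, ?_, ?_⟩
        · rintro _ ⟨e, he, rfl⟩
          exact hold _ (h1 he)
        · rintro _ ⟨e, he, rfl⟩ x hx
          obtain ⟨y, hy, rfl⟩ := Sym2.mem_map.1 hx
          rcases h3 e he y hy with h | h | h
          · exact Or.inl (by rw [h])
          · exact Or.inr (Or.inl (by rw [h]))
          · refine Or.inr (Or.inr ?_)
            rintro ⟨z, hz⟩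
            exact h ⟨z, Sum.inl_injective hz⟩
        · rintro _ ⟨e, he, rfl⟩
          obtain ⟨y, hy, h⟩ := h4 e he
          refine ⟨_, Sym2.mem_map.2 ⟨y, hy, rfl⟩, ?_⟩
          rintro ⟨z, hz⟩
          exact h ⟨z, Sum.inl_injective hz⟩
        · rintro j hj hij _ ⟨e, he, rfl⟩ he'
          by_cases hjM : j = M
          · rw [if_pos hjM] at he'
            exact hdisj _ he'
          · rw [if_neg hjM] at he'
            obtain ⟨e', he', heq⟩ := he'
            rw [Sym2.map.injective Sum.inl_injective heq] at he'
            exact h5 j (by omega) hij e he he'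

/-- Among more than `k * |E(G)|` edge-disjoint paths one does not cross the edges of `G`. -/
lemma exists_uncrossed {W : Type} [Finite W] {H : SimpleGraph W} (D : Drawing H) (k : ℕ)
    (hD : D.IsKPlanar k) (S : Set (Sym2 W)) (M : ℕ) (hM : k * S.ncard < M)
    (T : ℕ → Set (Sym2 W)) (hT : ∀ i < M, ∀ j < M, i ≠ j → ∀ e ∈ T i, e ∉ T j) :
    ∃ i < M, ∀ e ∈ S, ∀ f ∈ T i, ¬ D.Crosses e f := by
  classical
  by_contra hcon
  have hcon' : ∀ i : Fin M, ∃ e f p, e ∈ S ∧ f ∈ T i ∧ D.IsCrossingPt e f p := by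
    intro i
    by_contra hno
    refine hcon ⟨i, i.isLt, fun e he f hf => ?_⟩
    rintro ⟨p, hp⟩
    exact hno ⟨e, f, p, he, hf, hp⟩
  choose e f p he hf hp using hcon'
  have hSf : S.Finite := Set.toFinite S
  set U : Finset (Sym2 W × Plane) := hSf.toFinset.biUnion (fun e => (hD e).1.toFinset) with hU
  have hUc : U.card ≤ hSf.toFinset.card * k := by
    apply Finset.card_biUnion_le_card_mul
    intro e _
    rw [← Set.ncard_eq_toFinset_card _ (hD e).1]
    exact (hD e).2
  rw [← Set.ncard_eq_toFinset_card _ hSf] at hUc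
  have hle : (Finset.univ : Finset (Fin M)).card ≤ U.card := by
    apply Finset.card_le_card_of_injOn (fun i => (f i, p i))
    · intro i _
      simp only [hU, Finset.coe_biUnion, Set.mem_iUnion]
      exact ⟨e i, by simpa using he i, by simpa [Drawing.crossingsOf] using hp i⟩
    · intro i _ j _ hij
      by_contra hne
      have hfe : f i = f j := congrArg Prod.fst hij
      exact hT i i.isLt j j.isLt (fun h => hne (Fin.ext h)) _ (hf i) (hfe ▸ hf j)
  rw [Finset.card_univ, Fintype.card_fin] at hle
  rw [mul_comm] at hM
  omega

/-- The invariant: in each `k`-planar drawing of `G` the pairs in `L` are joined by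
internally disjoint paths that pairwise do not cross. -/
def PathInv (k : ℕ) (L : List (Fin 5 × Fin 5)) : Prop :=
  ∃ (V : Type) (_ : Fintype V) (G : SimpleGraph V) (ι : Fin 5 → V), IsKPlanarGraph G k ∧
    Function.Injective ι ∧
    ∀ D : Drawing G, D.IsKPlanar k → ∃ T : Fin 5 × Fin 5 → Set (Sym2 V),
      ∀ p ∈ L, T p ⊆ G.edgeSet ∧ TConn (T p) (ι p.1) (ι p.2) ∧
        (∀ e ∈ T p, ∀ x ∈ e, x ∈ Set.range ι → x = ι p.1 ∨ x = ι p.2) ∧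
        (∀ q ∈ L, p ≠ q → ∀ e ∈ T p, ∀ f ∈ T q,
          ¬ D.Crosses e f ∧ ∀ x ∈ e, x ∈ f → x ∈ Set.range ι)

lemma Drawing.Crosses.symm {V : Type*} {G : SimpleGraph V} {D : Drawing G} {e f : Sym2 V}
    (h : D.Crosses e f) : D.Crosses f e := by
  obtain ⟨p, h1, h2, h3, h4, h5⟩ := h
  exact ⟨p, h2, h1, h3.symm, h5, h4⟩

lemma PathInv_nil (k : ℕ) : PathInv k [] := by
  refine ⟨Fin 5, inferInstance, ⊥, id, ?_, Function.injective_id, ?_⟩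
  · refine ⟨⟨fun i => ((i : ℕ), 0), fun _ _ => 0, ?_, by simp, by simp, by simp, by simp,
      by simp, by simp⟩, ?_⟩
    · intro i j h
      simp only [Prod.mk.injEq, Nat.cast_inj, and_true] at h
      exact Fin.ext h
    · intro e
      have : ∀ D : Drawing (⊥ : SimpleGraph (Fin 5)), D.crossingsOf e = ∅ := by
        intro D
        ext fp
        simp [Drawing.crossingsOf, Drawing.IsCrossingPt]
      rw [this]
      simp
  · intro D hD
    exact ⟨fun _ => ∅, by simp⟩

lemma PathInv_cons (k : ℕ) (hcl : PAClosed k) (L : List (Fin 5 × Fin 5)) (p : Fin 5 × Fin 5)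
    (hp : p.1 ≠ p.2) (hpL : p ∉ L) (h : PathInv k L) : PathInv k (p :: L) := by
  classical
  obtain ⟨V, iV, G, ι, hG, hι, hDr⟩ := h
  obtain ⟨V', iV', G', φ, hG', hφ, hhom, T, hT⟩ := exists_family k hcl V G hG (ι p.1) (ι p.2)
    (fun h => hp (hι h)) (k * G.edgeSet.ncard + 1)
  refine ⟨V', iV', G', fun a => φ (ι a), hG', hφ.comp hι, ?_⟩
  intro D hD
  obtain ⟨T₀, hT₀⟩ := hDr (D.restrict φ hφ hhom) (D.restrict_isKPlanar φ hφ hhom k hD)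
  obtain ⟨i, hi, hunc⟩ := exists_uncrossed D k hD (Sym2.map φ '' G.edgeSet) _
    (by rw [Set.ncard_image_of_injective _ (Sym2.map.injective hφ)]; exact Nat.lt_succ_self _) T (fun i hi => (hT i hi).2.2.2.2)
  obtain ⟨h1, h2, h3, h4, -⟩ := hT i hi
  have hnew : ∀ q ∈ L, ∀ e ∈ T i, ∀ f ∈ T₀ q, ¬ D.Crosses e (Sym2.map φ f) ∧
      ∀ x ∈ e, x ∈ Sym2.map φ f → x ∈ Set.range (fun a => φ (ι a)) := by
    intro q hq e he f hf
    refine ⟨fun hx => hunc _ ⟨f, (hT₀ q hq).1 hf, rfl⟩ e he hx.symm, ?_⟩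
    intro x hx hxf
    obtain ⟨y, hy, rfl⟩ := Sym2.mem_map.1 hxf
    rcases h3 e he _ hx with h | h | h
    · exact ⟨p.1, h.symm⟩
    · exact ⟨p.2, h.symm⟩
    · exact absurd ⟨y, rfl⟩ h
  have hneL : ∀ q ∈ L, q ≠ p := fun q hq h => hpL (h ▸ hq)
  refine ⟨fun q => if q = p then T i else Sym2.map φ '' T₀ q, ?_⟩
  intro q hq
  by_cases hqp : q = p
  · subst hqp
    simp only [if_true]
    refine ⟨h1, h2, ?_, ?_⟩
    · rintro e he x hx ⟨a, rfl⟩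
      rcases h3 e he _ hx with h | h | h
      · exact Or.inl h
      · exact Or.inr h
      · exact absurd ⟨_, rfl⟩ h
    · intro r hr hne e he f hf
      rw [if_neg hne.symm] at hf
      obtain ⟨f, hf, rfl⟩ := hf
      have hrL : r ∈ L := (List.mem_cons.1 hr).resolve_left hne.symm
      exact hnew r hrL e he f hf
  · simp only [hqp, if_false]
    have hqL : q ∈ L := (List.mem_cons.1 hq).resolve_left hqp
    obtain ⟨g1, g2, g3, g4⟩ := hT₀ q hqL
    refine ⟨?_, g2.map φ, ?_, ?_⟩
    · rintro _ ⟨e, he, rfl⟩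
      exact hhom e (g1 he)
    · rintro _ ⟨e, he, rfl⟩ x hx ⟨a, rfl⟩
      obtain ⟨y, hy, hxy⟩ := Sym2.mem_map.1 hx
      have hy' : y = ι a := hφ hxy
      rcases g3 e he y hy ⟨a, hy'.symm⟩ with h | h
      · exact Or.inl (by rw [← h, hy'])
      · exact Or.inr (by rw [← h, hy'])
    · rintro r hr hne _ ⟨e, he, rfl⟩ f hf
      by_cases hrp : r = p
      · rw [if_pos hrp] at hf
        obtain ⟨k1, k2⟩ := hnew q hqL f hf e he
        exact ⟨fun h => k1 h.symm, fun x hx hx' => k2 x hx' hx⟩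
      · rw [if_neg hrp] at hf
        obtain ⟨f, hf, rfl⟩ := hf
        have hrL : r ∈ L := (List.mem_cons.1 hr).resolve_left hrp
        obtain ⟨k1, k2⟩ := g4 r hrL hne e he f hf
        refine ⟨?_, ?_⟩
        · rintro ⟨z, hz⟩
          exact k1 ⟨z, (D.restrict_isCrossingPt φ hφ hhom e f z).2
            ⟨g1 he, (hT₀ r hrL).1 hf, hz⟩⟩
        · intro x hx hx'
          obtain ⟨y, hy, rfl⟩ := Sym2.mem_map.1 hx
          obtain ⟨y', hy', hyy⟩ := Sym2.mem_map.1 hx'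
          rw [hφ hyy] at hy'
          obtain ⟨a, rfl⟩ := k2 y hy hy'
          exact ⟨a, rfl⟩

/-- The plane as the complex numbers. -/
def toC (x : Plane) : ℂ := ⟨x.1, x.2⟩

lemma toC_continuous : Continuous toC := by
  have : toC = fun x : Plane => (x.1 : ℂ) + x.2 * Complex.I := by
    funext x
    apply Complex.ext <;> simp [toC]
  rw [this]
  fun_prop

lemma toC_injective : Function.Injective toC := by
  intro x y h
  exact Prod.ext (congrArg Complex.re h) (congrArg Complex.im h)

lemma edge_joined {V : Type*} {G : SimpleGraph V} (D : Drawing G) (x y : V) (h : G.Adj x y) :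
    JoinedIn (D.curve s(x, y) '' Set.Icc 0 1) (D.pos x) (D.pos y) := by
  have hc := D.curve_cont s(x, y) h
  have hpc : IsPathConnected (D.curve s(x, y) '' Set.Icc 0 1) :=
    ((convex_Icc (0 : ℝ) 1).isPathConnected ⟨0, by simp⟩).image' hc
  have hends := D.curve_ends x y h
  have h0 : D.curve s(x, y) 0 ∈ D.curve s(x, y) '' Set.Icc 0 1 := ⟨0, by simp, rfl⟩
  have h1 : D.curve s(x, y) 1 ∈ D.curve s(x, y) '' Set.Icc 0 1 := ⟨1, by simp, rfl⟩
  have hmem : ∀ z ∈ ({D.pos x, D.pos y} : Set Plane), z ∈ D.curve s(x, y) '' Set.Icc 0 1 := by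
    intro z hz
    rw [← hends] at hz
    rcases hz with rfl | rfl
    · exact h0
    · exact h1
  exact hpc.joinedIn _ (hmem _ (by simp)) _ (hmem _ (by simp))

lemma conn_joined {V : Type*} {G : SimpleGraph V} (D : Drawing G) (T : Set (Sym2 V))
    (hT : T ⊆ G.edgeSet) (x y : V) (h : TConn T x y) :
    x = y ∨ JoinedIn (⋃ e ∈ T, D.curve e '' Set.Icc 0 1) (D.pos x) (D.pos y) := by
  induction h with
  | refl => exact Or.inl rfl
  | @tail b c hab hbc ih =>
    right
    have h1 : JoinedIn (⋃ e ∈ T, D.curve e '' Set.Icc 0 1) (D.pos b) (D.pos c) :=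
      (edge_joined D b c (hT hbc)).mono
        (Set.subset_biUnion_of_mem (u := fun e => D.curve e '' Set.Icc 0 1) hbc)
    rcases ih with rfl | ih
    · exact h1
    · exact ih.trans h1

/-- Non-crossing edges without common vertices have disjoint curves. -/
lemma curves_disjoint {V : Type*} {G : SimpleGraph V} (D : Drawing G) (e f : Sym2 V)
    (he : e ∈ G.edgeSet) (hf : f ∈ G.edgeSet) (hx : ¬ D.Crosses e f)
    (hv : ∀ x ∈ e, x ∉ f) (s t : ℝ) (hs : s ∈ Set.Icc (0 : ℝ) 1) (ht : t ∈ Set.Icc (0 : ℝ) 1) :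
    D.curve e s ≠ D.curve f t := by
  have hcl : ∀ g ∈ G.edgeSet, ∀ r ∈ Set.Icc (0 : ℝ) 1,
      r ∈ Set.Ioo (0 : ℝ) 1 ∨ ∃ x ∈ g, D.curve g r = D.pos x := by
    intro g hg r hr
    induction g using Sym2.ind with
    | _ x y =>
      have hends := D.curve_ends x y hg
      have hh : ∀ z ∈ ({D.curve s(x, y) 0, D.curve s(x, y) 1} : Set Plane),
          ∃ w ∈ s(x, y), z = D.pos w := by
        intro z hz
        rw [hends] at hz
        rcases hz with rfl | rfl
        · exact ⟨x, by simp, rfl⟩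
        · exact ⟨y, by simp, rfl⟩
      rcases eq_or_lt_of_le hr.1 with h | h
      · right; rw [← h]; exact hh _ (by simp)
      · rcases eq_or_lt_of_le hr.2 with h' | h'
        · right; rw [h']; exact hh _ (by simp)
        · exact Or.inl ⟨h, h'⟩
  intro heq
  obtain ⟨w, hw⟩ : ∃ w, w ∈ e := by
    induction e using Sym2.ind with
    | _ x y => exact ⟨x, by simp⟩
  have hne : e ≠ f := fun h => hv w hw (h ▸ hw)
  rcases hcl e he s hs with h1 | ⟨x, hxe, h1⟩
  · rcases hcl f hf t ht with h2 | ⟨y, hyf, h2⟩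
    · exact hx ⟨_, he, hf, hne, ⟨s, h1, rfl⟩, ⟨t, h2, heq.symm⟩⟩
    · exact D.no_vertex_interior e he s h1 y (heq.trans h2)
  · rcases hcl f hf t ht with h2 | ⟨y, hyf, h2⟩
    · exact D.no_vertex_interior f hf t h2 x (heq.symm.trans h1)
    · have : x = y := D.pos_inj (h1.symm.trans (heq.trans h2))
      exact hv x hxe (this ▸ hyf)

lemma PathInv_false (k : ℕ) (L : List (Fin 5 × Fin 5)) (hL : ∀ i j : Fin 5, i < j → (i, j) ∈ L)
    (h : PathInv k L) : False := by
  obtain ⟨V, iV, G, ι, ⟨D, hD⟩, hι, hDr⟩ := h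
  obtain ⟨T, hT⟩ := hDr D hD
  have hpath : ∀ i j : Fin 5, ∃ g : ℝ → Plane, i < j → Continuous g ∧ g 0 = D.pos (ι i) ∧
      g 1 = D.pos (ι j) ∧ ∀ s, g s ∈ ⋃ e ∈ T (i, j), D.curve e '' Set.Icc 0 1 := by
    intro i j
    by_cases hij : i < j
    · obtain ⟨h1, h2, -, -⟩ := hT (i, j) (hL i j hij)
      rcases conn_joined D _ h1 _ _ h2 with h | ⟨P, hP⟩
      · exact absurd (hι h) hij.ne
      · refine ⟨P.extend, fun _ => ⟨P.continuous_extend, P.extend_zero, P.extend_one, ?_⟩⟩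
        intro s
        exact hP _
    · exact ⟨fun _ => 0, fun h => absurd h hij⟩
  choose g hg using hpath
  refine no_planar_K5 (fun i => toC (D.pos (ι i))) (fun i j s => toC (g i j s)) ?_ ?_ ?_ ?_
  · intro i j hij
    exact toC_continuous.comp (hg i j hij).1
  · intro i j hij
    simp only [(hg i j hij).2.1]
  · intro i j hij
    simp only [(hg i j hij).2.2.1]
  · intro i j a b hij hab hia hib hja hjb s t heq
    have heq' := toC_injective heq
    have m1 := (hg i j hij).2.2.2 s
    have m2 := (hg a b hab).2.2.2 t
    simp only [Set.mem_iUnion] at m1 m2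
    obtain ⟨e, he, s', hs', e1⟩ := m1
    obtain ⟨f, hf, t', ht', e2⟩ := m2
    obtain ⟨p1, -, p3, p4⟩ := hT (i, j) (hL i j hij)
    obtain ⟨q1, -, q3, -⟩ := hT (a, b) (hL a b hab)
    obtain ⟨r1, r2⟩ := p4 (a, b) (hL a b hab) (fun h => hia (congrArg Prod.fst h)) e he f hf
    refine curves_disjoint D e f (p1 he) (q1 hf) r1 ?_ s' t' hs' ht'
      (e1.trans (heq'.trans e2.symm))
    intro x hx hxf
    have hr := r2 x hx hxf
    have c1 := p3 e he x hx hr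
    have c2 := q3 f hf x hxf hr
    simp only at c1 c2
    rcases c1 with rfl | rfl <;> rcases c2 with c | c
    · exact hia (hι c)
    · exact hib (hι c)
    · exact hja (hι c)
    · exact hjb (hι c)

lemma not_PAClosed (k : ℕ) : ¬ PAClosed k := by
  intro hcl
  have hall : ∀ L : List (Fin 5 × Fin 5), L.Nodup → (∀ p ∈ L, p.1 ≠ p.2) → PathInv k L := by
    intro L
    induction L with
    | nil => intro _ _; exact PathInv_nil k
    | cons p L ih =>
      intro hnd hne
      rw [List.nodup_cons] at hnd
      exact PathInv_cons k hcl L p (hne p (by simp)) hnd.1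
        (ih hnd.2 (fun q hq => hne q (by simp [hq])))
  let S : Finset (Fin 5 × Fin 5) := Finset.univ.filter (fun p => p.1 < p.2)
  refine PathInv_false k S.toList ?_ (hall S.toList S.nodup_toList ?_)
  · intro i j hij
    simp [S, hij]
  · intro p hp
    have : p.1 < p.2 := by simpa [S] using hp
    exact this.ne

/-- For every `k ≥ 0` the class of `k`-planar graphs is not closed
under path-addition: there are a `k`-planar graph `G`, distinct vertices `u, v`, and a
path of length at least `|V(G)| - 1` with new internal vertices such that for every
supplementary edge set the resulting graph is not `k`-planar. -/
theorem kPlanar_not_closedUnderPathAddition (k : ℕ) :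
    ∃ (V : Type) (iV : Fintype V) (G : SimpleGraph V),
      IsKPlanarGraph G k ∧
      ∃ u v : V, u ≠ v ∧
        ∃ t : ℕ, @Fintype.card V iV - 1 ≤ t + 1 ∧
          ∀ F : Set (Sym2 (V ⊕ Fin t)), ValidSupp F →
            ¬ IsKPlanarGraph (pathAdd G u v t F) k := by
  by_contra hcon
  push Not at hcon
  apply not_PAClosed k
  intro V iV G hG u v huv t ht
  obtain ⟨F, -, hF⟩ := hcon V iV G hG u v huv t ht
  exact ⟨F, hF⟩
end
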